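/- arXiv:2011.03401 — 3 statements merged into one kernel-verified Lean document; each statement's English description precedes it below -/
import Mathlib

section
/- Let K be a field, n ≥ 0, R = K[x_0,…,x_n] and S = K[x_0,…,x_{n+1}] with R ⊆ S, both standard graded. Let I ⊆ S be a homogeneous ideal that is saturated, i.e., for every f ∈ S, if x_i·f ∈ I for all i = 0,…,n+1 then f ∈ I. Write h_{S/I}(d) := dim_K (S/I)_d, with the convention h_{S/I}(−1) = 0. Then there exists a lexsegment ideal L ⊆ R such that dim_K (R/L)_d = h_{S/I}(d) − h_{S/I}(d−1) for all d ≥ 0, and dim_K (S/(L·S))_d = h_{S/I}(d) for all d ≥ 0. -/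
open MvPolynomial

/-- The Hilbert function of the graded quotient by a homogeneous ideal `I`:
`hilb K I d` is the `K`-dimension of the degree-`d` homogeneous component of the
quotient, computed as `dim_K (S_d / (I ∩ S_d))` where `S_d` is the space of
homogeneous polynomials of degree `d`. -/
noncomputable def hilb (K : Type) [Field K] {σ : Type} (I : Ideal (MvPolynomial σ K))
    (d : ℕ) : ℕ :=
  Module.finrank K
    ((homogeneousSubmodule σ K d) ⧸
      (Submodule.comap (homogeneousSubmodule σ K d).subtype (Submodule.restrictScalars K I)))

/-- A homogeneous ideal `L ⊆ K[x_0,…,x_n]` is lexsegment if every graded piece is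
spanned by monomials (equivalently, `L` is a monomial ideal) and, whenever a monomial
`x^a` of degree `d` lies in `L` and `x^b` is a monomial of degree `d` that is
lexicographically larger (with `x_0 > x_1 > ⋯ > x_n`), then `x^b ∈ L`. -/
def IsLexsegment {n : ℕ} {K : Type} [Field K] (L : Ideal (MvPolynomial (Fin (n+1)) K)) :
    Prop :=
  (∀ p ∈ L, ∀ a ∈ p.support, monomial a (1 : K) ∈ L) ∧
  (∀ a b : Fin (n+1) →₀ ℕ, (∑ i : Fin (n+1), a i) = (∑ i : Fin (n+1), b i) →
    monomial a (1 : K) ∈ L → toLex a < toLex b → monomial b (1 : K) ∈ L)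

/-- A set of exponents closed under lowering one coordinate by one is a lower set. -/
theorem isLowerSet_of_add_single {ι : Type*} [Fintype ι] [DecidableEq ι] {B : Set (ι → ℕ)}
    (h : ∀ x i, x + Pi.single i 1 ∈ B → x ∈ B) : IsLowerSet B := by
  have key : ∀ k : ℕ, ∀ x z : ι → ℕ, ∑ i, z i = k → x + z ∈ B → x ∈ B := by
    intro k
    induction k with
    | zero =>
      intro x z hz hx
      have : z = 0 := by
        funext i
        simpa using Finset.sum_eq_zero_iff.1 hz i (Finset.mem_univ i)
      simpa [this] using hx
    | succ k ih =>
      intro x z hz hx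
      obtain ⟨i, -, hi⟩ := Finset.exists_ne_zero_of_sum_ne_zero (by rw [hz]; simp : ∑ i, z i ≠ 0)
      have hzi : z = (z - Pi.single i 1) + Pi.single i 1 := by
        funext j
        by_cases hj : j = i
        · subst hj; simp; omega
        · simp [hj]
      refine ih x (z - Pi.single i 1) ?_ (h _ i ?_)
      · have := congrArg (fun f : ι → ℕ => ∑ i, f i) hzi
        simp only [Pi.add_apply, Finset.sum_add_distrib, Finset.sum_pi_single', Finset.mem_univ,
          if_true, hz] at this
        omega
      · rw [add_assoc, ← hzi]; exact hx
  intro x y hyx hx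
  exact key _ y (x - y) rfl (by rwa [add_tsub_cancel_of_le hyx])

section Compression

variable {ι : Type*}

/-- Exponents `x` and `y` agree away from `p` and `q` and have the same total degree there. -/
def SameFiber (p q : ι) (x y : ι → ℕ) : Prop :=
  (∀ i, i ≠ p → i ≠ q → x i = y i) ∧ x p + x q = y p + y q

theorem SameFiber.symm {p q : ι} {x y : ι → ℕ} (h : SameFiber p q x y) : SameFiber p q y x :=
  ⟨fun i hp hq => (h.1 i hp hq).symm, h.2.symm⟩

theorem SameFiber.trans {p q : ι} {x y z : ι → ℕ} (h : SameFiber p q x y)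
    (h' : SameFiber p q y z) : SameFiber p q x z :=
  ⟨fun i hp hq => (h.1 i hp hq).trans (h'.1 i hp hq), h.2.trans h'.2⟩

theorem SameFiber.eq_of_apply_eq {p q : ι} {x y : ι → ℕ} (h : SameFiber p q x y)
    (hq : x q = y q) : x = y := by
  funext i
  by_cases hi : i = q
  · rw [hi, hq]
  · by_cases hip : i = p
    · have := h.2
      rw [hip]; omega
    · exact h.1 i hip hi

open Classical in
/-- The elements of `B` in the fiber of `x`. -/
noncomputable def fiberOf (p q : ι) (B : Finset (ι → ℕ)) (x : ι → ℕ) : Finset (ι → ℕ) :=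
  {y ∈ B | SameFiber p q x y}

theorem mem_fiberOf {p q : ι} {B : Finset (ι → ℕ)} {x y : ι → ℕ} :
    y ∈ fiberOf p q B x ↔ y ∈ B ∧ SameFiber p q x y := by simp [fiberOf]

theorem fiberOf_congr {p q : ι} (B : Finset (ι → ℕ)) {x y : ι → ℕ} (h : SameFiber p q x y) :
    fiberOf p q B x = fiberOf p q B y := by
  ext z
  simp only [mem_fiberOf]
  exact and_congr_right fun _ => ⟨h.symm.trans, h.trans⟩

theorem fiberOf_injOn (p q : ι) (B : Finset (ι → ℕ)) (x : ι → ℕ) :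
    Set.InjOn (fun z : ι → ℕ => z q) (fiberOf p q B x : Set (ι → ℕ)) := by
  intro y hy z hz h
  rw [Finset.mem_coe, mem_fiberOf] at hy hz
  exact (hy.2.symm.trans hz.2).eq_of_apply_eq h

/-- The position of `y` in its fiber, ordered by the `q`-th coordinate. -/
noncomputable def fiberRank (p q : ι) (B : Finset (ι → ℕ)) (y : ι → ℕ) : ℕ :=
  ((fiberOf p q B y).filter fun z => z q < y q).card

theorem fiberRank_le (p q : ι) (B : Finset (ι → ℕ)) (y : ι → ℕ) : fiberRank p q B y ≤ y q := by
  have := Finset.card_le_card_of_injOn (s := (fiberOf p q B y).filter fun z => z q < y q)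
    (t := Finset.range (y q)) (fun z => z q) (fun z hz => by simpa using (Finset.mem_filter.1 hz).2)
    ((fiberOf_injOn p q B y).mono (Finset.coe_subset.2 (Finset.filter_subset _ _)))
  simpa [fiberRank] using this

theorem fiberRank_lt_card {p q : ι} {B : Finset (ι → ℕ)} {y : ι → ℕ} (hy : y ∈ B) :
    fiberRank p q B y < (fiberOf p q B y).card := by
  apply Finset.card_lt_card
  refine Finset.filter_ssubset.2 ⟨y, mem_fiberOf.2 ⟨hy, fun _ _ _ => rfl, rfl⟩, by simp⟩

theorem fiberRank_lt_fiberRank {p q : ι} {B : Finset (ι → ℕ)} {y z : ι → ℕ} (hy : y ∈ B)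
    (h : SameFiber p q y z) (hlt : y q < z q) : fiberRank p q B y < fiberRank p q B z := by
  unfold fiberRank
  rw [fiberOf_congr B h]
  apply Finset.card_lt_card
  rw [Finset.ssubset_iff_of_subset]
  · exact ⟨y, Finset.mem_filter.2 ⟨mem_fiberOf.2 ⟨hy, h.symm⟩, hlt⟩, by simp⟩
  · intro w hw
    rw [Finset.mem_filter] at hw ⊢
    exact ⟨hw.1, hw.2.trans hlt⟩

variable [DecidableEq ι]

/-- The element of the fiber of `y` with `q`-th coordinate `t`. -/
def fiberMove (p q : ι) (y : ι → ℕ) (t : ℕ) : ι → ℕ :=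
  Function.update (Function.update y q t) p (y p + y q - t)

theorem fiberMove_apply_right {p q : ι} (hpq : p ≠ q) (y : ι → ℕ) (t : ℕ) :
    fiberMove p q y t q = t := by
  simp [fiberMove, hpq.symm]

theorem fiberMove_apply_left (p q : ι) (y : ι → ℕ) (t : ℕ) :
    fiberMove p q y t p = y p + y q - t := by
  simp [fiberMove]

theorem sameFiber_fiberMove {p q : ι} (hpq : p ≠ q) (y : ι → ℕ) {t : ℕ} (ht : t ≤ y p + y q) :
    SameFiber p q y (fiberMove p q y t) := by
  refine ⟨fun i hp hq => by simp [fiberMove, hp, hq], ?_⟩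
  rw [fiberMove_apply_right hpq, fiberMove_apply_left]; omega

theorem SameFiber.sum_eq [Fintype ι] {p q : ι} (hpq : p ≠ q) {x y : ι → ℕ}
    (h : SameFiber p q x y) : ∑ i, x i = ∑ i, y i := by
  have key : ∀ z : ι → ℕ, ∑ i, z i = z p + (z q + ∑ i ∈ (Finset.univ.erase p).erase q, z i) := by
    intro z
    rw [Finset.add_sum_erase _ _ (by simp [hpq.symm]), Finset.add_sum_erase _ _ (by simp)]
  rw [key, key]
  have : ∑ i ∈ (Finset.univ.erase p).erase q, x i = ∑ i ∈ (Finset.univ.erase p).erase q, y i :=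
    Finset.sum_congr rfl fun i hi => by
      simp only [Finset.mem_erase] at hi
      exact h.1 i hi.2.1 hi.1
  have := h.2
  omega

/-- Lowering a degree of a lower set in the two variables `p`, `q` loses at most the full fiber. -/
theorem min_card_fiberOf_le {p q : ι} (hpq : p ≠ q) {B : Finset (ι → ℕ)}
    (hB : IsLowerSet (B : Set (ι → ℕ))) {x x' : ι → ℕ}
    (h : ∀ i, i ≠ p → i ≠ q → x' i = x i) (hs : x p + x q = x' p + x' q + 1) :
    min (fiberOf p q B x).card (x p + x q) ≤ (fiberOf p q B x').card := by
  have hmem : ∀ z ∈ fiberOf p q B x, ∀ r, r = p ∨ r = q → z r ≠ 0 →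
      z - Pi.single r 1 ∈ fiberOf p q B x' := by
    intro z hz r hr hzr
    rw [mem_fiberOf] at hz ⊢
    refine ⟨hB (a := z) (fun i => by simp) hz.1, fun i hp hq => ?_, ?_⟩
    · have : i ≠ r := by rintro rfl; tauto
      simp [this, h i hp hq, hz.2.1 i hp hq]
    · have := hz.2.2
      rcases hr with rfl | rfl
      · simp [hpq.symm]; omega
      · simp [hpq]; omega
  by_cases hfull : ∀ t, t ≤ x p + x q → fiberMove p q x t ∈ B
  · refine (min_le_right _ _).trans ?_
    have := Finset.card_le_card_of_injOn (s := Finset.range (x p + x q))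
      (t := fiberOf p q B x') (fun t => fiberMove p q x t - Pi.single p 1) ?_ ?_
    · simpa using this
    · intro t ht
      have ht : t < x p + x q := by simpa using ht
      refine hmem _ (mem_fiberOf.2 ⟨hfull t ht.le, sameFiber_fiberMove hpq x ht.le⟩) p (Or.inl rfl) ?_
      rw [fiberMove_apply_left]; omega
    · intro s _ t _ hst
      have := congrFun hst q
      simpa [hpq.symm, fiberMove_apply_right hpq] using this
  · push Not at hfull
    obtain ⟨t, ht, htB⟩ := hfull
    have hne : ∀ z ∈ fiberOf p q B x, z q ≠ t := by
      intro z hz hzt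
      rw [mem_fiberOf] at hz
      apply htB
      have := (hz.2.symm.trans (sameFiber_fiberMove hpq x ht)).eq_of_apply_eq
        (by rw [fiberMove_apply_right hpq, hzt])
      exact this ▸ hz.1
    refine (min_le_left _ _).trans ?_
    refine Finset.card_le_card_of_injOn
      (fun z => if z q < t then z - Pi.single p 1 else z - Pi.single q 1) ?_ ?_
    · intro z hz
      have h1 := hne z hz
      have h2 := (mem_fiberOf.1 hz).2.2
      dsimp only
      split_ifs with hzt
      · exact hmem z hz p (Or.inl rfl) (by omega)
      · exact hmem z hz q (Or.inr rfl) (by omega)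
    · intro y hy z hz hyz
      have h1 := hne y hy
      have h2 := hne z hz
      apply fiberOf_injOn p q B x hy hz
      have := congrFun hyz q
      dsimp only at this ⊢
      split_ifs at this <;> simp [hpq.symm] at this <;> omega

theorem sameFiber_compress {p q : ι} (hpq : p ≠ q) (B : Finset (ι → ℕ)) (y : ι → ℕ) :
    SameFiber p q y (fiberMove p q y (fiberRank p q B y)) :=
  sameFiber_fiberMove hpq y ((fiberRank_le p q B y).trans (Nat.le_add_left _ _))

theorem injOn_compress {p q : ι} (hpq : p ≠ q) (B : Finset (ι → ℕ)) :
    Set.InjOn (fun y => fiberMove p q y (fiberRank p q B y)) (B : Set (ι → ℕ)) := by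
  intro y hy z hz h
  dsimp only at h
  have hyz : SameFiber p q y z :=
    (sameFiber_compress hpq B y).trans (h ▸ (sameFiber_compress hpq B z).symm)
  have hr : fiberRank p q B y = fiberRank p q B z := by
    rw [← fiberMove_apply_right hpq y (fiberRank p q B y), h, fiberMove_apply_right hpq]
  rcases lt_trichotomy (y q) (z q) with hlt | heq | hlt
  · exact absurd hr (fiberRank_lt_fiberRank hy hyz hlt).ne
  · exact hyz.eq_of_apply_eq heq
  · exact absurd hr (fiberRank_lt_fiberRank hz hyz.symm hlt).ne'

variable [Fintype ι]

/-- The compression of `B` in the direction from `q` to `p`. -/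
noncomputable def compress (p q : ι) (B : Finset (ι → ℕ)) : Finset (ι → ℕ) :=
  B.image fun y => fiberMove p q y (fiberRank p q B y)

theorem mem_compress {p q : ι} (hpq : p ≠ q) {B : Finset (ι → ℕ)} {x : ι → ℕ} :
    x ∈ compress p q B ↔ x q < (fiberOf p q B x).card := by
  constructor
  · intro hx
    obtain ⟨y, hy, rfl⟩ := Finset.mem_image.1 hx
    rw [fiberMove_apply_right hpq, ← fiberOf_congr B (sameFiber_compress hpq B y)]
    exact fiberRank_lt_card hy
  · intro hx
    have hinj : Set.InjOn (fiberRank p q B) (fiberOf p q B x : Set (ι → ℕ)) := by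
      intro y hy z hz h
      rw [Finset.mem_coe, mem_fiberOf] at hy hz
      have hyz := hy.2.symm.trans hz.2
      rcases lt_trichotomy (y q) (z q) with hlt | heq | hlt
      · exact absurd h (fiberRank_lt_fiberRank hy.1 hyz hlt).ne
      · exact hyz.eq_of_apply_eq heq
      · exact absurd h (fiberRank_lt_fiberRank hz.1 hyz.symm hlt).ne'
    have himg : (fiberOf p q B x).image (fiberRank p q B) =
        Finset.range (fiberOf p q B x).card := by
      apply Finset.eq_of_subset_of_card_le
      · intro r hr
        obtain ⟨y, hy, rfl⟩ := Finset.mem_image.1 hr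
        rw [mem_fiberOf] at hy
        rw [Finset.mem_range, fiberOf_congr B hy.2]
        exact fiberRank_lt_card hy.1
      · rw [Finset.card_range, Finset.card_image_of_injOn hinj]
    have : x q ∈ (fiberOf p q B x).image (fiberRank p q B) := by
      rw [himg]; simpa using hx
    obtain ⟨y, hy, hyr⟩ := Finset.mem_image.1 this
    rw [mem_fiberOf] at hy
    refine Finset.mem_image.2 ⟨y, hy.1, ?_⟩
    have h := hy.2.trans (sameFiber_compress hpq B y)
    refine (h.eq_of_apply_eq ?_).symm
    rw [fiberMove_apply_right hpq, hyr]

theorem isLowerSet_compress {p q : ι} (hpq : p ≠ q) {B : Finset (ι → ℕ)}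
    (hB : IsLowerSet (B : Set (ι → ℕ))) : IsLowerSet (compress p q B : Set (ι → ℕ)) := by
  apply isLowerSet_of_add_single
  intro x i hx
  rw [Finset.mem_coe, mem_compress hpq] at hx ⊢
  by_cases hip : i = p
  · subst hip
    have := min_card_fiberOf_le hpq hB (x := x + Pi.single i 1) (x' := x)
      (fun j h1 h2 => by simp [h1]) (by simp [hpq.symm]; omega)
    simp [hpq.symm] at this hx
    omega
  by_cases hiq : i = q
  · subst hiq
    have := min_card_fiberOf_le hpq hB (x := x + Pi.single i 1) (x' := x)
      (fun j h1 h2 => by simp [h2]) (by simp [hpq]; omega)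
    simp [hpq] at this hx
    omega
  · refine lt_of_lt_of_le (by simpa [Ne.symm hiq] using hx) ?_
    refine Finset.card_le_card_of_injOn (fun z => z - Pi.single i 1) ?_ ?_
    · intro z hz
      rw [Finset.mem_coe, mem_fiberOf] at hz ⊢
      refine ⟨hB (a := z) (fun j => by simp) hz.1, fun j hp hq => ?_, ?_⟩
      · have := hz.2.1 j hp hq
        simp only [Pi.add_apply, Pi.sub_apply] at this ⊢
        omega
      · simpa [Ne.symm hip, Ne.symm hiq] using hz.2.2
    · intro y hy z hz hyz
      apply fiberOf_injOn p q B _ hy hz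
      simpa [Ne.symm hiq] using congrFun hyz q

/-- Every finite lower set can be replaced by one with the same number of elements in each degree
which is stable under moving a unit of degree from any coordinate to the coordinate `p`. -/
theorem exists_stable (p : ι) (B : Finset (ι → ℕ))
    (hB : IsLowerSet (B : Set (ι → ℕ))) :
    ∃ B' : Finset (ι → ℕ), IsLowerSet (B' : Set (ι → ℕ)) ∧
      (∀ d, (B'.filter fun x => ∑ i, x i = d).card = (B.filter fun x => ∑ i, x i = d).card) ∧
      ∀ (x : ι → ℕ) (q : ι), x + Pi.single q 1 ∈ B' → x + Pi.single p 1 ∈ B' := by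
  induction hμ : ∑ y ∈ B, (∑ i, y i - y p) using Nat.strong_induction_on generalizing B with
  | _ μ ih =>
  by_cases hst : ∀ q, q ≠ p → ∀ y ∈ B, fiberRank p q B y = y q
  · refine ⟨B, hB, fun _ => rfl, fun x q hx => ?_⟩
    by_cases hq : q = p
    · rwa [← hq]
    have hrk := hst q hq _ hx
    have himg : ((fiberOf p q B (x + Pi.single q 1)).filter
        fun z => z q < (x + Pi.single q 1 : ι → ℕ) q).image (fun z => z q) =
        Finset.range ((x + Pi.single q 1 : ι → ℕ) q) := by
      apply Finset.eq_of_subset_of_card_le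
      · intro t ht
        obtain ⟨z, hz, rfl⟩ := Finset.mem_image.1 ht
        simpa using (Finset.mem_filter.1 hz).2
      · rw [Finset.card_range, Finset.card_image_of_injOn]
        · exact hrk.ge
        · exact (fiberOf_injOn p q B _).mono (Finset.coe_subset.2 (Finset.filter_subset _ _))
    have hxq : x q ∈ Finset.range ((x + Pi.single q 1 : ι → ℕ) q) := by simp
    rw [← himg, Finset.mem_image] at hxq
    obtain ⟨z, hz, hzq⟩ := hxq
    have hz := mem_fiberOf.1 (Finset.mem_filter.1 hz).1
    convert hz.1
    have hsf : SameFiber p q (x + Pi.single p 1) (x + Pi.single q 1) :=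
      ⟨fun i h1 h2 => by simp [h1, h2], by simp [hq, Ne.symm hq]; omega⟩
    refine (hsf.trans hz.2).eq_of_apply_eq ?_
    simp [hq, hzq]
  · push Not at hst
    obtain ⟨q, hqp, y, hy, hyr⟩ := hst
    have hpq : p ≠ q := hqp.symm
    have hlt : ∑ y ∈ compress p q B, (∑ i, y i - y p) < μ := by
      rw [← hμ, compress, Finset.sum_image (injOn_compress hpq B)]
      have hle : ∀ z : ι → ℕ, z p ≤ ∑ i, z i ∧ z p + z q ≤ ∑ i, z i := fun z =>
        ⟨Finset.single_le_sum (f := z) (fun _ _ => Nat.zero_le _) (Finset.mem_univ p), by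
          rw [← Finset.sum_pair hpq]
          exact Finset.sum_le_sum_of_subset (Finset.subset_univ _)⟩
      apply Finset.sum_lt_sum
      · intro z _
        rw [← (sameFiber_compress hpq B z).sum_eq hpq, fiberMove_apply_left]
        have := fiberRank_le p q B z
        have := hle z
        omega
      · refine ⟨y, hy, ?_⟩
        rw [← (sameFiber_compress hpq B y).sum_eq hpq, fiberMove_apply_left]
        have := fiberRank_le p q B y
        have := hle y
        omega
    obtain ⟨B', h1, h2, h3⟩ := ih _ hlt (compress p q B) (isLowerSet_compress hpq hB) rfl
    refine ⟨B', h1, fun d => (h2 d).trans ?_, h3⟩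
    rw [compress, Finset.filter_image, Finset.card_image_of_injOn]
    · congr 1
      refine Finset.filter_congr fun z _ => ?_
      rw [← (sameFiber_compress hpq B z).sum_eq hpq]
    · exact (injOn_compress hpq B).mono (Finset.coe_subset.2 (Finset.filter_subset _ _))

end Compression

section LexRank

open Classical in
/-- The number of exponents of the same total degree which are lexicographically smaller. -/
noncomputable def lexRank {n : ℕ} (m : Fin n → ℕ) : ℕ :=
  ((Finset.univ.piAntidiag (∑ i, m i)).filter fun x => toLex x < toLex m).card

open Classical in
theorem lexRank_add_one {n : ℕ} (m : Fin n → ℕ) :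
    lexRank m + 1 =
      ((Finset.univ.piAntidiag (∑ i, m i)).filter fun x => toLex x ≤ toLex m).card := by
  have hm : m ∉ (Finset.univ.piAntidiag (∑ i, m i)).filter fun x => toLex x < toLex m :=
    fun h => lt_irrefl _ (Finset.mem_filter.1 h).2
  rw [lexRank, ← Finset.card_insert_of_notMem hm]
  congr 1
  ext x
  simp only [Finset.mem_insert, Finset.mem_filter, Finset.mem_piAntidiag, Finset.mem_univ,
    implies_true, and_true, le_iff_lt_or_eq, toLex_inj]
  constructor
  · rintro (rfl | h)
    · simp
    · exact ⟨h.1, Or.inl h.2⟩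
  · rintro ⟨h, h' | h'⟩
    · exact Or.inr ⟨h, h'⟩
    · exact Or.inl h'

open Classical in
theorem lexRank_lt_lexRank {n : ℕ} {x y : Fin n → ℕ} (hs : ∑ i, x i = ∑ i, y i)
    (h : toLex x < toLex y) : lexRank x < lexRank y := by
  rw [← Nat.succ_le_iff, Nat.succ_eq_add_one, lexRank_add_one, lexRank, hs]
  refine Finset.card_le_card fun z hz => ?_
  rw [Finset.mem_filter] at hz ⊢
  exact ⟨hz.1, hz.2.trans_lt h⟩

theorem lexRank_le_lexRank {n : ℕ} {x y : Fin n → ℕ} (hs : ∑ i, x i = ∑ i, y i)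
    (h : toLex x ≤ toLex y) : lexRank x ≤ lexRank y := by
  rcases h.lt_or_eq with h | h
  · exact (lexRank_lt_lexRank hs h).le
  · rw [toLex_inj.1 h]

theorem lexRank_injOn (n d : ℕ) :
    Set.InjOn lexRank ((Finset.univ.piAntidiag d : Finset (Fin n → ℕ)) : Set (Fin n → ℕ)) := by
  intro x hx y hy h
  have hx : ∑ i, x i = d := by simpa using hx
  have hy : ∑ i, y i = d := by simpa using hy
  rcases lt_trichotomy (toLex x) (toLex y) with hlt | heq | hlt
  · exact absurd h (lexRank_lt_lexRank (hx.trans hy.symm) hlt).ne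
  · exact toLex_inj.1 heq
  · exact absurd h (lexRank_lt_lexRank (hy.trans hx.symm) hlt).ne'

open Classical in
theorem card_filter_lexRank_lt {n d k : ℕ}
    (hk : k ≤ (Finset.univ.piAntidiag d : Finset (Fin n → ℕ)).card) :
    ((Finset.univ.piAntidiag d : Finset (Fin n → ℕ)).filter fun m => lexRank m < k).card = k := by
  have himg : (Finset.univ.piAntidiag d : Finset (Fin n → ℕ)).image lexRank =
      Finset.range (Finset.univ.piAntidiag d : Finset (Fin n → ℕ)).card := by
    apply Finset.eq_of_subset_of_card_le
    · intro r hr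
      obtain ⟨y, hy, rfl⟩ := Finset.mem_image.1 hr
      have hy' : ∑ i, y i = d := by simpa using hy
      rw [Finset.mem_range, lexRank, hy']
      exact Finset.card_lt_card (Finset.filter_ssubset.2 ⟨y, hy, lt_irrefl _⟩)
    · rw [Finset.card_range, Finset.card_image_of_injOn (lexRank_injOn n d)]
  rw [← Finset.card_image_of_injOn
    ((lexRank_injOn n d).mono (Finset.coe_subset.2 (Finset.filter_subset _ _)))]
  have : ((Finset.univ.piAntidiag d : Finset (Fin n → ℕ)).filter
      fun m => lexRank m < k).image lexRank = Finset.range k := by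
    ext r
    constructor
    · intro hr
      obtain ⟨m, hm, rfl⟩ := Finset.mem_image.1 hr
      exact Finset.mem_range.2 (Finset.mem_filter.1 hm).2
    · intro hr
      have hr' := Finset.range_subset_range.2 hk hr
      rw [← himg] at hr'
      obtain ⟨m, hm, rfl⟩ := Finset.mem_image.1 hr'
      exact Finset.mem_image_of_mem _ (Finset.mem_filter.2 ⟨hm, Finset.mem_range.1 hr⟩)
  rw [this, Finset.card_range]

theorem init_injOn (n d : ℕ) :
    Set.InjOn (fun x : Fin (n + 1) → ℕ => fun i : Fin n => x i.castSucc) {x | ∑ i, x i = d} := by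
  intro x hx y hy h
  simp only [Set.mem_ofPred_eq, Fin.sum_univ_castSucc] at hx hy
  have h' : ∀ i : Fin n, x i.castSucc = y i.castSucc := congrFun h
  funext i
  refine Fin.lastCases ?_ h' i
  simp only [h'] at hx
  omega

/-- Raising the last coordinate until the degree agrees preserves the lexicographic order. -/
theorem toLex_add_single_last_le {n : ℕ} {u w : Fin (n + 1) → ℕ} (h : toLex u < toLex w)
    {t : ℕ} (hs : ∑ i, u i + t = ∑ i, w i) :
    toLex (u + Pi.single (Fin.last n) t) ≤ toLex w := by
  obtain ⟨k, hk, hlt⟩ := h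
  simp only [Pi.toLex_apply] at hk hlt
  by_cases hkl : k = Fin.last n
  · subst hkl
    apply le_of_eq
    rw [toLex_inj]
    refine init_injOn n (∑ i, w i) ?_ rfl ?_
    · simp [Finset.sum_add_distrib, hs]
    · funext i
      simpa using hk _ (Fin.castSucc_lt_last i)
  · refine le_of_lt ⟨k, fun j hj => ?_, ?_⟩
    · have : j ≠ Fin.last n := (hj.trans_le (Fin.le_last k)).ne
      simpa [this] using hk j hj
    · simpa [hkl] using hlt

theorem toLex_single_last_le {n : ℕ} (i : Fin (n + 1)) :
    toLex (Pi.single (Fin.last n) 1 : Fin (n + 1) → ℕ) ≤ toLex (Pi.single i 1) := by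
  by_cases hi : i = Fin.last n
  · rw [hi]
  · refine le_of_lt ⟨i, fun j hj => ?_, ?_⟩
    · have : j ≠ Fin.last n := (hj.trans_le (Fin.le_last i)).ne
      simp [this, hj.ne]
    · simp [hi]

theorem sum_add_single {ι : Type*} [Fintype ι] [DecidableEq ι] (x : ι → ℕ) (i : ι) (t : ℕ) :
    ∑ j, (x + Pi.single i t : ι → ℕ) j = ∑ j, x j + t := by
  simp [Finset.sum_add_distrib]

/-- Among finite sets of given size in degrees at most `d + 1`, a lexicographically initial one has
the fewest elements in degrees at most `d`, compared with those sets which are lower sets and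
satisfy Macaulay's bound. -/
theorem card_filter_le_of_lex {n d : ℕ} {E F : Finset (Fin n → ℕ)}
    (hE : ∀ u ∈ E, ∑ i, u i ≤ d + 1) (hF : ∀ u ∈ F, ∑ i, u i ≤ d + 1)
    (hlex : ∀ u ∈ F, ∀ w ∉ F, ∑ i, w i = d + 1 → toLex u < toLex w)
    (hcard : F.card ≤ E.card)
    (hmac : IsLowerSet {u : Fin n → ℕ | lexRank u < (E.filter fun x => ∑ i, x i = ∑ i, u i).card}) :
    (F.filter fun u => ∑ i, u i ≤ d).card ≤ (E.filter fun u => ∑ i, u i ≤ d).card := by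
  have hsplit : ∀ G : Finset (Fin n → ℕ), (∀ u ∈ G, ∑ i, u i ≤ d + 1) →
      (G.filter fun u => ∑ i, u i ≤ d).card + (G.filter fun u => ∑ i, u i = d + 1).card =
        G.card := by
    intro G hG
    rw [← Finset.card_filter_add_card_filter_not (s := G) (fun u => ∑ i, u i ≤ d)]
    congr 2
    refine Finset.filter_congr fun u hu => ?_
    have := hG u hu
    omega
  have hEs := hsplit E hE
  have hFs := hsplit F hF
  by_cases htop : (E.filter fun u => ∑ i, u i = d + 1).card ≤
      (F.filter fun u => ∑ i, u i = d + 1).card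
  · omega
  push Not at htop
  have hdeg : ∀ j, (E.filter fun u => ∑ i, u i = j).card ≤
      (Finset.univ.piAntidiag j : Finset (Fin n → ℕ)).card := fun j =>
    Finset.card_le_card fun u hu => by simpa using (Finset.mem_filter.1 hu).2
  obtain ⟨w, hw, hwF⟩ : ∃ w ∈ (Finset.univ.piAntidiag (d + 1) : Finset (Fin n → ℕ)).filter
      (fun m => lexRank m < (E.filter fun u => ∑ i, u i = d + 1).card),
      w ∉ F.filter fun u => ∑ i, u i = d + 1 :=
    Finset.exists_mem_notMem_of_card_lt_card (by rwa [card_filter_lexRank_lt (hdeg _)])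
  simp only [Finset.mem_filter, Finset.mem_piAntidiag, Finset.mem_univ, implies_true,
    and_true] at hw hwF
  obtain ⟨hw, hwr⟩ := hw
  have hwF : w ∉ F := fun h => hwF ⟨h, hw⟩
  have hj : ∀ j ∈ Finset.range (d + 1), (F.filter fun u => ∑ i, u i = j).card ≤
      (E.filter fun u => ∑ i, u i = j).card := by
    intro j hj
    rw [Finset.mem_range] at hj
    conv_rhs => rw [← card_filter_lexRank_lt (hdeg j)]
    refine Finset.card_le_card fun u hu => ?_
    obtain ⟨huF, huj⟩ := Finset.mem_filter.1 hu
    simp only [Finset.mem_filter, Finset.mem_piAntidiag, Finset.mem_univ, implies_true, and_true]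
    refine ⟨huj, ?_⟩
    have hlt := hlex u huF w hwF hw
    cases n with
    | zero => exact absurd (congrArg toLex (Subsingleton.elim u w)) hlt.ne
    | succ n =>
      have hsum : ∑ i, (u + Pi.single (Fin.last n) (d + 1 - j) : Fin (n + 1) → ℕ) i = d + 1 := by
        rw [sum_add_single, huj]; omega
      have hle := toLex_add_single_last_le hlt (t := d + 1 - j) (by rw [huj, hw]; omega)
      have := hmac (a := u + Pi.single (Fin.last n) (d + 1 - j)) (b := u)
        (fun i => by simp) (by
          rw [Set.mem_ofPred_eq, hsum]
          exact (lexRank_le_lexRank (hsum.trans hw.symm) hle).trans_lt hwr)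
      rwa [Set.mem_ofPred_eq, huj] at this
  have hsum : ∀ G : Finset (Fin n → ℕ), (G.filter fun u => ∑ i, u i ≤ d).card =
      ∑ j ∈ Finset.range (d + 1), (G.filter fun u => ∑ i, u i = j).card := by
    intro G
    rw [Finset.card_eq_sum_card_fiberwise (f := fun u : Fin n → ℕ => ∑ i, u i)
      (t := Finset.range (d + 1))]
    · refine Finset.sum_congr rfl fun j hj => ?_
      rw [Finset.filter_filter]
      congr 1
      refine Finset.filter_congr fun u _ => ?_
      rw [Finset.mem_range] at hj
      omega
    · intro u hu
      have := (Finset.mem_filter.1 hu).2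
      simpa [Nat.lt_succ_iff] using this
  rw [hsum, hsum]
  exact Finset.sum_le_sum hj

open Classical in
/-- **Macaulay's theorem**: replacing each degree of a finite lower set of exponents by the
lexicographically smallest exponents yields a lower set. -/
theorem isLowerSet_lexRank_lt (n : ℕ) (B : Finset (Fin n → ℕ))
    (hB : IsLowerSet (B : Set (Fin n → ℕ))) :
    IsLowerSet {m : Fin n → ℕ | lexRank m < (B.filter fun x => ∑ i, x i = ∑ i, m i).card} := by
  induction n with
  | zero =>
    intro a b _ ha
    rwa [Subsingleton.elim b a]
  | succ n ih =>
    obtain ⟨B', hB', hcard, hst⟩ := exists_stable (Fin.last n) B hB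
    simp only [← hcard]
    clear hcard hB B
    apply isLowerSet_of_add_single
    intro x i hx
    rw [Set.mem_ofPred_eq, sum_add_single] at hx
    rw [Set.mem_ofPred_eq]
    set d := ∑ j, x j with hd
    let init : (Fin (n + 1) → ℕ) → Fin n → ℕ := fun y j => y j.castSucc
    have hinit : ∀ y, ∑ j, y j = ∑ j, init y j + y (Fin.last n) := fun y => Fin.sum_univ_castSucc y
    set m := x + Pi.single i 1 with hm
    have hmd : ∑ j, m j = d + 1 := sum_add_single x i 1
    set E := (B'.filter fun y => ∑ j, y j = d + 1).image init with hEdef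
    set F := ((Finset.univ.piAntidiag (d + 1)).filter fun v => toLex v ≤ toLex m).image init
      with hFdef
    have hEmem : ∀ u, u ∈ E ↔ ∃ y ∈ B', ∑ j, y j = d + 1 ∧ init y = u := fun u => by
      simp [hEdef, and_assoc]
    have hFmem : ∀ u, u ∈ F ↔ ∃ v : Fin (n + 1) → ℕ, ∑ j, v j = d + 1 ∧ toLex v ≤ toLex m ∧
        init v = u := fun u => by
      simp [hFdef, and_assoc]
    have hElow : IsLowerSet (E : Set (Fin n → ℕ)) := by
      apply isLowerSet_of_add_single
      intro u k hu
      rw [Finset.mem_coe, hEmem] at hu ⊢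
      obtain ⟨y, hy, hyd, hyu⟩ := hu
      let z : Fin (n + 1) → ℕ := Fin.snoc u (y (Fin.last n))
      have hzy : z + Pi.single k.castSucc 1 = y := by
        funext j
        refine Fin.lastCases ?_ (fun j => ?_) j
        · simp [z]
        · have := congrFun hyu j
          simp only [init] at this
          simp [z, this, Pi.single_apply]
      refine ⟨z + Pi.single (Fin.last n) 1, hst z k.castSucc (hzy ▸ hy), ?_, ?_⟩
      · rw [sum_add_single, ← hyd, ← hzy, sum_add_single]
      · funext j
        simp [init, z]
    have hEF := card_filter_le_of_lex (d := d) (E := E) (F := F) ?_ ?_ ?_ ?_ (ih E hElow)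
    · have h1 : lexRank x + 1 ≤ (F.filter fun u => ∑ j, u j ≤ d).card := by
        rw [lexRank_add_one, ← hd]
        refine Finset.card_le_card_of_injOn init ?_ ((init_injOn n d).mono fun v hv => by
          simpa using (Finset.mem_filter.1 hv).1)
        intro v hv
        simp only [Finset.coe_filter, Finset.mem_piAntidiag, Finset.mem_univ, implies_true,
          and_true, Set.mem_ofPred_eq] at hv
        rw [Finset.mem_coe, Finset.mem_filter, hFmem]
        refine ⟨⟨v + Pi.single (Fin.last n) 1, by rw [sum_add_single, hv.1], ?_, ?_⟩, ?_⟩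
        · exact add_le_add hv.2 (toLex_single_last_le i)
        · funext j
          simp [init]
        · have h1 := hinit v
          have h2 : ∑ j, v j = d := hv.1
          omega
      have h2 : (E.filter fun u => ∑ j, u j ≤ d).card ≤
          (B'.filter fun y => ∑ j, y j = d).card := by
        refine Finset.card_le_card_of_injOn
          (fun u => (Fin.snoc u (d - ∑ j, u j) : Fin (n + 1) → ℕ)) ?_ ?_
        · intro u hu
          rw [Finset.mem_coe, Finset.mem_filter, hEmem] at hu
          obtain ⟨⟨y, hy, hyd, rfl⟩, hle⟩ := hu
          have := hinit y
          rw [Finset.mem_coe, Finset.mem_filter]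
          constructor
          · refine hB' (a := y) (fun j => ?_) hy
            refine Fin.lastCases ?_ (fun j => ?_) j
            · simp only [Fin.snoc_last]; omega
            · simp [init]
          · rw [Fin.sum_univ_castSucc]
            simp only [Fin.snoc_castSucc, Fin.snoc_last]
            omega
        · intro u _ v _ huv
          funext j
          simpa using congrFun huv j.castSucc
      omega
    · intro u hu
      obtain ⟨y, -, hyd, rfl⟩ := (hEmem u).1 hu
      have := hinit y
      omega
    · intro u hu
      obtain ⟨y, hyd, -, rfl⟩ := (hFmem u).1 hu
      have := hinit y
      omega
    · intro u hu w hw hwd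
      obtain ⟨v, hvd, hvm, rfl⟩ := (hFmem u).1 hu
      let w' : Fin (n + 1) → ℕ := Fin.snoc w 0
      have hw'w : init w' = w := by
        funext j
        simp [init, w']
      have hlt : toLex v < toLex w' := by
        refine hvm.trans_lt (lt_of_not_ge fun h => hw ((hFmem w).2 ⟨w', ?_, h, hw'w⟩))
        rw [hinit, hw'w, hwd]
        simp [w']
      obtain ⟨k, hk, hkl⟩ := hlt
      simp only [Pi.toLex_apply] at hk hkl
      revert hk hkl
      refine Fin.lastCases ?_ (fun k => ?_) k
      · intro _ h
        simp [w'] at h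
      · intro hk hkl
        refine ⟨k, fun j hj => ?_, ?_⟩
        · simpa [w', init] using hk j.castSucc (by simpa using hj)
        · simpa [w', init] using hkl
    · rw [hFdef, hEdef, Finset.card_image_of_injOn, Finset.card_image_of_injOn]
      · rw [← hmd, ← lexRank_add_one, hmd]
        exact hx
      · exact (init_injOn n (d + 1)).mono fun v hv => (Finset.mem_filter.1 hv).2
      · exact (init_injOn n (d + 1)).mono fun v hv => by
          simpa using (Finset.mem_filter.1 hv).1

end LexRank

section LeadingExponents

variable {K : Type} [Field K] {n : ℕ}

/-- The finitely supported function attached to an exponent vector. -/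
noncomputable abbrev expFinsupp (x : Fin n → ℕ) : Fin n →₀ ℕ := Finsupp.equivFunOnFinite.symm x

theorem expFinsupp_degree (x : Fin n → ℕ) : (expFinsupp x).degree = ∑ i, x i := by
  simp [Finsupp.degree_eq_sum]

theorem expFinsupp_coe (a : Fin n →₀ ℕ) : expFinsupp (a : Fin n → ℕ) = a := by
  ext; simp

theorem expFinsupp_add_single (x : Fin n → ℕ) (i : Fin n) (t : ℕ) :
    expFinsupp (x + Pi.single i t) = expFinsupp x + Finsupp.single i t := by
  ext j
  simp [Finsupp.single_eq_pi_single]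

/-- `x` is the lexicographically largest exponent of a homogeneous element of `I`. -/
def IsLeading (I : Ideal (MvPolynomial (Fin n) K)) (x : Fin n → ℕ) : Prop :=
  ∃ p ∈ I, p.IsHomogeneous (∑ i, x i) ∧ coeff (expFinsupp x) p ≠ 0 ∧
    ∀ y : Fin n → ℕ, toLex x < toLex y → coeff (expFinsupp y) p = 0

open Classical in
/-- The degree `d` exponents which are not leading exponents of `I`. -/
noncomputable def stdExponents (I : Ideal (MvPolynomial (Fin n) K)) (d : ℕ) :
    Finset (Fin n → ℕ) :=
  (Finset.univ.piAntidiag d).filter fun x => ¬ IsLeading I x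

theorem mem_stdExponents {I : Ideal (MvPolynomial (Fin n) K)} {d : ℕ} {x : Fin n → ℕ} :
    x ∈ stdExponents I d ↔ ∑ i, x i = d ∧ ¬ IsLeading I x := by
  simp [stdExponents]

theorem monomial_mem_homogeneousSubmodule {d : ℕ} {x : Fin n → ℕ} (hx : ∑ i, x i = d) :
    monomial (expFinsupp x) (1 : K) ∈ homogeneousSubmodule (Fin n) K d :=
  isHomogeneous_monomial _ (by rw [expFinsupp_degree, hx])

theorem sum_eq_of_mem_support {d : ℕ} {p : MvPolynomial (Fin n) K} (hp : p.IsHomogeneous d)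
    {a : Fin n →₀ ℕ} (ha : a ∈ p.support) : ∑ i, a i = d := by
  rw [hp.degree_eq_sum_deg_support ha]
  exact (Finsupp.degree_eq_sum a).symm

theorem form_eq_sum {d : ℕ} {p : MvPolynomial (Fin n) K} (hp : p.IsHomogeneous d) :
    (⟨p, hp⟩ : homogeneousSubmodule (Fin n) K d) =
      ∑ a ∈ p.support.attach, coeff a.1 p • (⟨monomial (expFinsupp a.1) 1,
        monomial_mem_homogeneousSubmodule (sum_eq_of_mem_support hp a.2)⟩ :
          homogeneousSubmodule (Fin n) K d) := by
  ext1
  simp only [expFinsupp_coe, Submodule.coe_sum, Submodule.coe_smul]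
  rw [Finset.sum_attach p.support (fun a => coeff a p • monomial a (1 : K))]
  conv_lhs => rw [p.as_sum]
  simp [smul_monomial]

/-- The degree `d` part of the ideal `I`, as a subspace of the forms of degree `d`. -/
noncomputable abbrev gradedPart (I : Ideal (MvPolynomial (Fin n) K)) (d : ℕ) :
    Submodule K (homogeneousSubmodule (Fin n) K d) :=
  Submodule.comap (homogeneousSubmodule (Fin n) K d).subtype (Submodule.restrictScalars K I)

/-- The class of a monomial of degree `d` modulo `I`. -/
noncomputable def stdClass (I : Ideal (MvPolynomial (Fin n) K)) (d : ℕ)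
    (x : stdExponents I d) : homogeneousSubmodule (Fin n) K d ⧸ gradedPart I d :=
  Submodule.Quotient.mk
    ⟨monomial (expFinsupp x.1) 1, monomial_mem_homogeneousSubmodule (mem_stdExponents.1 x.2).1⟩

theorem linearIndependent_stdClass (I : Ideal (MvPolynomial (Fin n) K)) (d : ℕ) :
    LinearIndependent K (stdClass I d) := by
  rw [Fintype.linearIndependent_iff]
  classical
  intro g hg
  by_contra! hne
  obtain ⟨x0, hx0⟩ := hne
  obtain ⟨x, hx, hmax⟩ := Finset.exists_max_image
    (Finset.univ.filter fun x : stdExponents I d => g x ≠ 0) (fun x => toLex x.1) ⟨x0, by simpa⟩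
  have hgx : g x ≠ 0 := by simpa using hx
  have hxd := mem_stdExponents.1 x.2
  set p : MvPolynomial (Fin n) K := ∑ x, g x • monomial (expFinsupp x.1) 1 with hp
  have hcoeff : ∀ y, coeff (expFinsupp y) p = ∑ x, if x.1 = y then g x else 0 := by
    intro y
    simp [hp, coeff_sum, coeff_smul, coeff_monomial]
  refine hxd.2 ⟨p, ?_, ?_, ?_, ?_⟩
  · have : (Submodule.Quotient.mk (∑ x, g x • (⟨monomial (expFinsupp x.1) 1,
        monomial_mem_homogeneousSubmodule (mem_stdExponents.1 x.2).1⟩ :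
        homogeneousSubmodule (Fin n) K d)) : _ ⧸ gradedPart I d) = 0 := by
      rw [← hg]
      simp only [stdClass, ← Submodule.mkQ_apply, map_sum, map_smul]
    rw [Submodule.Quotient.mk_eq_zero] at this
    simpa [hp] using this
  · rw [hxd.1]
    exact Submodule.sum_mem _ fun y _ => Submodule.smul_mem _ _
      (monomial_mem_homogeneousSubmodule (mem_stdExponents.1 y.2).1)
  · rw [hcoeff, Finset.sum_eq_single x]
    · simpa using hgx
    · intro y _ hy
      rw [if_neg fun h => hy (Subtype.ext h)]
    · simp
  · intro y hxy
    rw [hcoeff]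
    refine Finset.sum_eq_zero fun z _ => ?_
    split_ifs with hz
    · by_contra hgz
      exact (hmax z (by simpa using hgz)).not_gt (hz ▸ hxy)
    · rfl

theorem span_stdClass (I : Ideal (MvPolynomial (Fin n) K)) (d : ℕ) :
    ⊤ ≤ Submodule.span K (Set.range (stdClass I d)) := by
  have key : ∀ x : Lex (Fin n → ℕ), ∀ hx : ∑ i, ofLex x i = d,
      (Submodule.Quotient.mk ⟨monomial (expFinsupp (ofLex x)) 1,
        monomial_mem_homogeneousSubmodule hx⟩ : _ ⧸ gradedPart I d) ∈
        Submodule.span K (Set.range (stdClass I d)) := by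
    intro x
    induction x using WellFoundedLT.induction with
    | _ x ih =>
    intro hx
    by_cases hlead : IsLeading I (ofLex x)
    · obtain ⟨p, hpI, hph, hpx, hpy⟩ := hlead
      rw [hx] at hph
      have hzero : (Submodule.Quotient.mk (⟨p, hph⟩ : homogeneousSubmodule (Fin n) K d) :
          _ ⧸ gradedPart I d) = 0 := by
        rw [Submodule.Quotient.mk_eq_zero]; exact hpI
      rw [form_eq_sum hph, ← Submodule.mkQ_apply, map_sum] at hzero
      have hxs : expFinsupp (ofLex x) ∈ p.support := mem_support_iff.2 hpx
      rw [← Finset.add_sum_erase _ _ (Finset.mem_attach _ ⟨_, hxs⟩), add_eq_zero_iff_eq_neg,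
        map_smul] at hzero
      have hmem : coeff (expFinsupp (ofLex x)) p • ((gradedPart I d).mkQ
          ⟨monomial (expFinsupp (ofLex x)) 1, monomial_mem_homogeneousSubmodule hx⟩) ∈
          Submodule.span K (Set.range (stdClass I d)) := by
        refine hzero ▸ Submodule.neg_mem _ (Submodule.sum_mem _ fun a ha => ?_)
        rw [map_smul]
        refine Submodule.smul_mem _ _ (ih (toLex (a.1 : Fin n → ℕ)) ?_
          (sum_eq_of_mem_support hph a.2))
        have hne : (a.1 : Fin n → ℕ) ≠ ofLex x := by
          rintro h
          exact (Finset.mem_erase.1 ha).1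
            (Subtype.ext ((expFinsupp_coe _).symm.trans (congrArg expFinsupp h)))
        rcases lt_trichotomy (toLex (a.1 : Fin n → ℕ)) x with h | h | h
        · exact h
        · exact absurd (congrArg ofLex h) hne
        · have := hpy a.1 h
          rw [expFinsupp_coe] at this
          exact absurd this (mem_support_iff.1 a.2)
      exact (Submodule.smul_mem_iff _ hpx).1 hmem
    · exact Submodule.subset_span ⟨⟨ofLex x, mem_stdExponents.2 ⟨hx, hlead⟩⟩, rfl⟩
  rintro v -
  obtain ⟨⟨p, hp⟩, rfl⟩ := Submodule.Quotient.mk_surjective _ v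
  rw [form_eq_sum hp, ← Submodule.mkQ_apply, map_sum]
  refine Submodule.sum_mem _ fun a _ => ?_
  rw [map_smul]
  exact Submodule.smul_mem _ _ 
    (key (toLex (a.1 : Fin n → ℕ)) (sum_eq_of_mem_support hp a.2))

/-- The monomials with standard exponents form a basis of each graded piece of the quotient. -/
theorem hilb_eq_card (I : Ideal (MvPolynomial (Fin n) K)) (d : ℕ) :
    hilb K I d = (stdExponents I d).card := by
  have := Module.finrank_eq_card_basis
    (Module.Basis.mk (linearIndependent_stdClass I d) (span_stdClass I d))
  rwa [Fintype.card_coe] at this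

theorem finite_quotient_gradedPart (I : Ideal (MvPolynomial (Fin n) K)) (d : ℕ) :
    Module.Finite K (homogeneousSubmodule (Fin n) K d ⧸ gradedPart I d) :=
  Module.Finite.of_basis (Module.Basis.mk (linearIndependent_stdClass I d) (span_stdClass I d))

theorem IsLeading.add_single {I : Ideal (MvPolynomial (Fin n) K)} {x : Fin n → ℕ}
    (hx : IsLeading I x) (i : Fin n) : IsLeading I (x + Pi.single i 1) := by
  obtain ⟨p, hpI, hph, hpx, hpy⟩ := hx
  refine ⟨p * X i, I.mul_mem_right _ hpI, ?_, ?_, ?_⟩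
  · rw [sum_add_single]
    exact hph.mul (isHomogeneous_X K i)
  · rwa [expFinsupp_add_single, coeff_mul_X]
  · intro y hy
    by_cases hyi : y i = 0
    · rw [coeff_mul_X', if_neg (by simpa using hyi)]
    · have hy' : y = (y - Pi.single i 1) + Pi.single i 1 := by
        funext j
        by_cases hj : j = i
        · subst hj; simp; omega
        · simp [hj]
      rw [hy'] at hy ⊢
      rw [expFinsupp_add_single, coeff_mul_X]
      exact hpy _ (lt_of_add_lt_add_right (a := toLex (Pi.single i 1 : Fin n → ℕ)) hy)

theorem isLowerSet_not_isLeading (I : Ideal (MvPolynomial (Fin n) K)) :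
    IsLowerSet {x : Fin n → ℕ | ¬ IsLeading I x} :=
  isLowerSet_of_add_single fun _ i hx h => hx (h.add_single i)

end LeadingExponents

section BaseChange

variable {σ K : Type} [Field K] (F : Type) [Field F] [Algebra K F]

/-- The extension of an ideal to a larger field, described through the `K`-linear functionals on
the larger field. -/
def extendIdeal (I : Ideal (MvPolynomial σ K)) : Ideal (MvPolynomial σ F) where
  carrier := {p | ∀ φ : F →ₗ[K] K, ∃ q ∈ I, ∀ a, coeff a q = φ (coeff a p)}
  zero_mem' := fun φ => ⟨0, I.zero_mem, by simp⟩
  add_mem' := by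
    intro p p' hp hp' φ
    obtain ⟨q, hq, h⟩ := hp φ
    obtain ⟨q', hq', h'⟩ := hp' φ
    exact ⟨q + q', I.add_mem hq hq', fun a => by simp [h, h']⟩
  smul_mem' := by
    intro f p hp φ
    induction f using MvPolynomial.induction_on' generalizing φ with
    | monomial u c =>
      obtain ⟨q, hq, h⟩ := hp (φ ∘ₗ LinearMap.mulLeft K c)
      refine ⟨monomial u 1 * q, I.mul_mem_left _ hq, fun a => ?_⟩
      rw [smul_eq_mul, coeff_monomial_mul', coeff_monomial_mul']
      split_ifs
      · simp [h]
      · simp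
    | add f g hf hg =>
      obtain ⟨q, hq, h⟩ := hf φ
      obtain ⟨q', hq', h'⟩ := hg φ
      exact ⟨q + q', I.add_mem hq hq', fun a => by rw [add_smul, coeff_add, coeff_add, h, h', map_add]⟩

variable {F} {I : Ideal (MvPolynomial σ K)}

theorem map_mem_extendIdeal {p : MvPolynomial σ K} (hp : p ∈ I) :
    map (algebraMap K F) p ∈ extendIdeal F I := fun φ =>
  ⟨φ 1 • p, by rw [smul_eq_C_mul]; exact I.mul_mem_left _ hp, fun a => by
    rw [coeff_smul, coeff_map, Algebra.algebraMap_eq_smul_one, map_smul, smul_eq_mul, smul_eq_mul,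
      mul_comm]⟩

theorem homogeneousComponent_mem_extendIdeal (hI : ∀ p ∈ I, ∀ e, homogeneousComponent e p ∈ I)
    {p : MvPolynomial σ F} (hp : p ∈ extendIdeal F I) (e : ℕ) :
    homogeneousComponent e p ∈ extendIdeal F I := by
  intro φ
  obtain ⟨q, hq, h⟩ := hp φ
  refine ⟨homogeneousComponent e q, hI q hq e, fun a => ?_⟩
  rw [coeff_homogeneousComponent, coeff_homogeneousComponent]
  split_ifs <;> simp [h]

theorem mem_extendIdeal_of_forall_X_mul_mem
    (hsat : ∀ p : MvPolynomial σ K, (∀ i, X i * p ∈ I) → p ∈ I)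
    {p : MvPolynomial σ F} (hp : ∀ i, X i * p ∈ extendIdeal F I) : p ∈ extendIdeal F I := by
  classical
  intro φ
  have hcoeff : ∀ a, coeff a (∑ b ∈ p.support, monomial b (φ (coeff b p))) = φ (coeff a p) := by
    intro a
    rw [coeff_sum]
    simp only [coeff_monomial]
    rw [Finset.sum_ite_eq']
    split_ifs with h
    · rfl
    · rw [notMem_support_iff.1 h, map_zero]
  refine ⟨_, hsat _ fun i => ?_, hcoeff⟩
  obtain ⟨q, hq, h⟩ := hp i φ
  convert hq using 1
  ext a
  rw [h, coeff_X_mul', coeff_X_mul']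
  split_ifs
  · rw [hcoeff]
  · simp

theorem isLeading_extendIdeal {n : ℕ} {I : Ideal (MvPolynomial (Fin n) K)} (x : Fin n → ℕ) :
    IsLeading (extendIdeal F I) x ↔ IsLeading I x := by
  constructor
  · rintro ⟨p, hpI, hph, hpx, hpy⟩
    obtain ⟨φ, hφ⟩ : ∃ φ : Module.Dual K F, φ (coeff (expFinsupp x) p) ≠ 0 := by
      by_contra! h
      exact hpx ((Module.forall_dual_apply_eq_zero_iff K _).1 h)
    obtain ⟨q, hq, h⟩ := hpI φ
    refine ⟨q, hq, fun a ha => hph fun h0 => ha ?_, ?_, fun y hy => ?_⟩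
    · rw [h, h0, map_zero]
    · rwa [h]
    · rw [h, hpy y hy, map_zero]
  · rintro ⟨p, hpI, hph, hpx, hpy⟩
    refine ⟨map (algebraMap K F) p, map_mem_extendIdeal hpI, hph.map _, ?_, fun y hy => ?_⟩
    · rwa [coeff_map, map_ne_zero]
    · rw [coeff_map, hpy y hy, map_zero]

theorem hilb_extendIdeal {n : ℕ} (I : Ideal (MvPolynomial (Fin n) K)) (d : ℕ) :
    hilb F (extendIdeal F I) d = hilb K I d := by
  rw [hilb_eq_card, hilb_eq_card]
  congr 1
  ext x
  simp only [mem_stdExponents, isLeading_extendIdeal]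

end BaseChange

section HyperplaneSection

variable {K : Type} [Field K] {m : ℕ} (c : Fin m → K)

/-- Substitution of a linear form in the other variables for the last variable. -/
noncomputable def substLast : MvPolynomial (Fin (m + 1)) K →ₐ[K] MvPolynomial (Fin m) K :=
  aeval (Fin.snoc X (∑ i, C (c i) * X i) : Fin (m + 1) → MvPolynomial (Fin m) K)

/-- The linear form defining the hyperplane of `substLast`. -/
noncomputable def linForm : MvPolynomial (Fin (m + 1)) K :=
  X (Fin.last m) - ∑ i, C (c i) * X (Fin.castSucc i)

@[simp]
theorem substLast_X_castSucc (i : Fin m) : substLast c (X i.castSucc) = X i := by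
  simp [substLast]

@[simp]
theorem substLast_X_last : substLast c (X (Fin.last m)) = ∑ i, C (c i) * X i := by
  simp [substLast]

@[simp]
theorem substLast_rename (p : MvPolynomial (Fin m) K) :
    substLast c (rename Fin.castSucc p) = p := by
  have : (substLast c).comp (rename Fin.castSucc) = AlgHom.id K _ := by
    ext i
    simp
  exact DFunLike.congr_fun this p

theorem substLast_surjective : Function.Surjective (substLast c) := fun p =>
  ⟨_, substLast_rename c p⟩

theorem substLast_linForm : substLast c (linForm c) = 0 := by
  simp [linForm, algHom_C]

theorem linForm_isHomogeneous : (linForm c).IsHomogeneous 1 := by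
  refine (isHomogeneous_X K _).sub (IsHomogeneous.sum _ _ _ fun i _ => ?_)
  simpa using (isHomogeneous_C _ (c i)).mul (isHomogeneous_X K i.castSucc)

theorem isHomogeneous_substLast {p : MvPolynomial (Fin (m + 1)) K} {d : ℕ}
    (hp : p.IsHomogeneous d) : (substLast c p).IsHomogeneous d := by
  have h := hp.aeval (Fin.snoc X (∑ i, C (c i) * X i) : Fin (m + 1) → MvPolynomial (Fin m) K)
    (n := 1) (fun i => ?_)
  · rwa [one_mul] at h
  · induction i using Fin.lastCases with
    | last =>
      rw [Fin.snoc_last]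
      refine IsHomogeneous.sum _ _ _ fun i _ => ?_
      simpa using (isHomogeneous_C _ (c i)).mul (isHomogeneous_X K i)
    | cast i =>
      rw [Fin.snoc_castSucc]
      exact isHomogeneous_X K i

theorem exists_linForm_mul_eq (p : MvPolynomial (Fin (m + 1)) K) :
    ∃ r, p - rename Fin.castSucc (substLast c p) = linForm c * r := by
  have hvar : ∀ i, linForm c ∣ X i - rename Fin.castSucc (substLast c (X i)) := by
    intro i
    induction i using Fin.lastCases with
    | last => simp [linForm]
    | cast i => simp
  have h : ∀ p : MvPolynomial (Fin (m + 1)) K,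
      linForm c ∣ p - rename Fin.castSucc (substLast c p) := by
    intro p
    induction p using MvPolynomial.induction_on with
    | C a => simp [algHom_C]
    | add p q hp hq =>
      rw [map_add, map_add, add_sub_add_comm]
      exact dvd_add hp hq
    | mul_X p i hp =>
      rw [map_mul, map_mul]
      have := dvd_add (hp.mul_right (X i))
        ((hvar i).mul_left (rename Fin.castSucc (substLast c p)))
      convert this using 1
      ring
  exact h p

theorem exists_linForm_mul_eq_of_substLast_eq_zero {p : MvPolynomial (Fin (m + 1)) K}
    (hp : substLast c p = 0) : ∃ r, p = linForm c * r := by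
  simpa [hp] using exists_linForm_mul_eq c p

theorem homogeneousComponent_linForm_mul (r : MvPolynomial (Fin (m + 1)) K) (d : ℕ) :
    homogeneousComponent d (linForm c * r) =
      if d = 0 then 0 else linForm c * homogeneousComponent (d - 1) r := by
  conv_lhs => rw [← sum_homogeneousComponent r, Finset.mul_sum, map_sum]
  have hterm : ∀ i, homogeneousComponent d (linForm c * homogeneousComponent i r) =
      if d = i + 1 then linForm c * homogeneousComponent i r else 0 := by
    intro i
    rw [homogeneousComponent_of_mem (n := i + 1)]
    rw [add_comm i 1]
    exact (linForm_isHomogeneous c).mul (homogeneousComponent_isHomogeneous i r)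
  simp only [hterm]
  rcases d with _ | d
  · simp
  · simp only [Nat.add_right_cancel_iff, Finset.sum_ite_eq, Finset.mem_range, Nat.succ_ne_zero,
      if_false, Nat.add_sub_cancel]
    split_ifs with h
    · rfl
    · rw [homogeneousComponent_eq_zero _ _ (by omega), mul_zero]

variable (J : Ideal (MvPolynomial (Fin (m + 1)) K))

/-- The map induced by `substLast` on graded pieces of the quotients. -/
noncomputable def restrictQuotient (d : ℕ) :
    (homogeneousSubmodule (Fin (m + 1)) K d ⧸ gradedPart J d) →ₗ[K]
      (homogeneousSubmodule (Fin m) K d ⧸ gradedPart (J.map (substLast c)) d) :=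
  Submodule.mapQ _ _ ((substLast c).toLinearMap.restrict fun _ hp => isHomogeneous_substLast c hp)
    fun _ hp => Ideal.mem_map_of_mem _ hp

/-- Multiplication by `linForm` on graded pieces of the quotient. -/
noncomputable def mulLinForm (d : ℕ) :
    (homogeneousSubmodule (Fin (m + 1)) K d ⧸ gradedPart J d) →ₗ[K]
      (homogeneousSubmodule (Fin (m + 1)) K (d + 1) ⧸ gradedPart J (d + 1)) :=
  Submodule.mapQ _ _ ((LinearMap.mulLeft K (linForm c)).restrict
    (p := homogeneousSubmodule (Fin (m + 1)) K d)
    (q := homogeneousSubmodule (Fin (m + 1)) K (d + 1)) fun p hp => by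
      have := (linForm_isHomogeneous c).mul hp
      rwa [add_comm 1 d] at this)
    fun _ hp => J.mul_mem_left _ hp

theorem restrictQuotient_mk_eq_zero {d : ℕ} {p : MvPolynomial (Fin (m + 1)) K}
    (hp : p.IsHomogeneous d) :
    restrictQuotient c J d (Submodule.Quotient.mk ⟨p, hp⟩) = 0 ↔
      substLast c p ∈ J.map (substLast c) :=
  Submodule.Quotient.mk_eq_zero (gradedPart (J.map (substLast c)) d)
    (x := (⟨substLast c p, isHomogeneous_substLast c hp⟩ : homogeneousSubmodule (Fin m) K d))

theorem mulLinForm_mk_eq_zero {d : ℕ} {p : MvPolynomial (Fin (m + 1)) K}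
    (hp : p.IsHomogeneous d) :
    mulLinForm c J d (Submodule.Quotient.mk ⟨p, hp⟩) = 0 ↔ linForm c * p ∈ J :=
  Submodule.Quotient.mk_eq_zero (gradedPart J (d + 1))

theorem mk_eq_mulLinForm_mk {d : ℕ} {p q : MvPolynomial (Fin (m + 1)) K}
    (hp : p.IsHomogeneous (d + 1)) (hq : q.IsHomogeneous d) :
    Submodule.Quotient.mk ⟨p, hp⟩ = mulLinForm c J d (Submodule.Quotient.mk ⟨q, hq⟩) ↔
      p - linForm c * q ∈ J :=
  Submodule.Quotient.eq (gradedPart J (d + 1))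

theorem restrictQuotient_surjective (d : ℕ) : Function.Surjective (restrictQuotient c J d) := by
  intro v
  obtain ⟨⟨p, hp⟩, rfl⟩ := Submodule.Quotient.mk_surjective _ v
  refine ⟨Submodule.Quotient.mk ⟨rename Fin.castSucc p, IsHomogeneous.rename_isHomogeneous hp⟩, ?_⟩
  refine congrArg Submodule.Quotient.mk (Subtype.ext ?_)
  exact substLast_rename c p

variable {J}

theorem exists_sub_linForm_mul_mem (hJ : ∀ p ∈ J, ∀ e, homogeneousComponent e p ∈ J) {d : ℕ}
    {p : MvPolynomial (Fin (m + 1)) K} (hp : p.IsHomogeneous d)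
    (h : substLast c p ∈ J.map (substLast c)) :
    ∃ r, p - homogeneousComponent d (linForm c * r) ∈ J := by
  obtain ⟨j, hj, hjp⟩ := (Ideal.mem_map_iff_of_surjective _ (substLast_surjective c)).1 h
  obtain ⟨r, hr⟩ := exists_linForm_mul_eq_of_substLast_eq_zero c (p := p - j)
    (by rw [map_sub, hjp, sub_self])
  refine ⟨r, ?_⟩
  rw [← hr, map_sub, homogeneousComponent_eq_self hp, sub_sub_cancel]
  exact hJ j hj d

theorem hilb_map_substLast_zero (hJ : ∀ p ∈ J, ∀ e, homogeneousComponent e p ∈ J) :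
    hilb K (J.map (substLast c)) 0 = hilb K J 0 := by
  refine (LinearEquiv.ofBijective (restrictQuotient c J 0)
    ⟨?_, restrictQuotient_surjective c J 0⟩).finrank_eq.symm
  rw [injective_iff_map_eq_zero]
  intro v hv
  obtain ⟨⟨p, hp⟩, rfl⟩ := Submodule.Quotient.mk_surjective _ v
  obtain ⟨r, hr⟩ := exists_sub_linForm_mul_mem c hJ hp
    ((restrictQuotient_mk_eq_zero c J hp).1 hv)
  rw [homogeneousComponent_linForm_mul, if_pos rfl, sub_zero] at hr
  exact (Submodule.Quotient.mk_eq_zero _).2 hr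

theorem mulLinForm_injective (hc : ∀ p, linForm c * p ∈ J → p ∈ J) (d : ℕ) :
    Function.Injective (mulLinForm c J d) := by
  rw [injective_iff_map_eq_zero]
  intro v hv
  obtain ⟨⟨p, hp⟩, rfl⟩ := Submodule.Quotient.mk_surjective _ v
  exact (Submodule.Quotient.mk_eq_zero _).2 (hc p ((mulLinForm_mk_eq_zero c J hp).1 hv))

theorem ker_restrictQuotient (hJ : ∀ p ∈ J, ∀ e, homogeneousComponent e p ∈ J) (d : ℕ) :
    LinearMap.ker (restrictQuotient c J (d + 1)) = LinearMap.range (mulLinForm c J d) := by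
  ext v
  obtain ⟨⟨p, hp⟩, rfl⟩ := Submodule.Quotient.mk_surjective _ v
  rw [LinearMap.mem_ker, LinearMap.mem_range]
  constructor
  · intro hv
    obtain ⟨r, hr⟩ := exists_sub_linForm_mul_mem c hJ hp
      ((restrictQuotient_mk_eq_zero c J hp).1 hv)
    rw [homogeneousComponent_linForm_mul, if_neg (Nat.succ_ne_zero d), Nat.add_sub_cancel] at hr
    refine ⟨Submodule.Quotient.mk ⟨homogeneousComponent d r,
      homogeneousComponent_isHomogeneous d r⟩, Eq.symm ?_⟩
    exact (mk_eq_mulLinForm_mk c J hp _).2 hr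
  · rintro ⟨w, hw⟩
    obtain ⟨⟨q, hq⟩, rfl⟩ := Submodule.Quotient.mk_surjective _ w
    have hmem : p - linForm c * q ∈ J := (mk_eq_mulLinForm_mk c J hp hq).1 hw.symm
    refine (restrictQuotient_mk_eq_zero c J hp).2 ?_
    have := Ideal.mem_map_of_mem (substLast c) hmem
    rwa [map_sub, map_mul, substLast_linForm, zero_mul, sub_zero] at this

theorem hilb_map_substLast_succ (hJ : ∀ p ∈ J, ∀ e, homogeneousComponent e p ∈ J)
    (hc : ∀ p, linForm c * p ∈ J → p ∈ J) (d : ℕ) :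
    hilb K (J.map (substLast c)) (d + 1) + hilb K J d = hilb K J (d + 1) := by
  have := finite_quotient_gradedPart J (d + 1)
  have h := LinearMap.finrank_range_add_finrank_ker (restrictQuotient c J (d + 1))
  rwa [ker_restrictQuotient c hJ, LinearMap.finrank_range_of_inj (mulLinForm_injective c hc d),
    LinearMap.range_eq_top.2 (restrictQuotient_surjective c J (d + 1)), finrank_top] at h

end HyperplaneSection

section NonZeroDivisor

variable {K : Type} [Field K] {m : ℕ}

theorem exists_linForm_mul_mem [Infinite K] {J : Ideal (MvPolynomial (Fin (m + 1)) K)}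
    (hsat : ∀ p, (∀ i, X i * p ∈ J) → p ∈ J) :
    ∃ c : Fin m → K, ∀ p, linForm c * p ∈ J → p ∈ J := by
  classical
  let A := MvPolynomial (Fin (m + 1)) K
  have hfin := associatedPrimes.finite A (A ⧸ J)
  let φ : (Fin (m + 1) → K) →ₗ[K] A := Fintype.linearCombination K X
  have hφ : ∀ i, φ (Pi.single i 1) = X i := fun i => by
    simp [φ, Fintype.linearCombination_apply_single]
  let V : Ideal A → Subspace K (Fin (m + 1) → K) := fun P => (P.restrictScalars K).comap φ
  let W : Subspace K (Fin (m + 1) → K) := LinearMap.ker (LinearMap.proj (Fin.last m))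
  have htop : ⊤ ∉ insert W (hfin.toFinset.image V) := by
    rw [Finset.mem_insert, Finset.mem_image]
    rintro (h | ⟨P, hP, h⟩)
    · have : Pi.single (Fin.last m) (1 : K) ∈ W := h ▸ Submodule.mem_top
      simp [W] at this
    · rw [Set.Finite.mem_toFinset, AssociatedPrimes.mem_iff, isAssociatedPrime_iff] at hP
      obtain ⟨hprime, x, rfl⟩ := hP
      obtain ⟨p, rfl⟩ := Ideal.Quotient.mk_surjective x
      have hmem : ∀ q : A, q ∈ Submodule.colon (⊥ : Submodule A (A ⧸ J)) {Ideal.Quotient.mk J p} ↔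
          q * p ∈ J := by
        intro q
        rw [Submodule.mem_colon_singleton, Submodule.mem_bot, ← Ideal.Quotient.eq_zero_iff_mem,
          map_mul]
        rfl
      have hp : p ∈ J := hsat p fun i => by
        rw [← hmem, ← hφ]
        have : Pi.single i (1 : K) ∈ V _ := h ▸ Submodule.mem_top
        exact this
      refine hprime.ne_top ((Ideal.eq_top_iff_one _).2 ((hmem 1).2 ?_))
      rwa [one_mul]
  obtain ⟨v, hv⟩ := (Set.ne_univ_iff_exists_notMem _).1 (Subspace.biUnion_ne_univ_of_top_notMem htop)
  simp only [Set.mem_iUnion, not_exists, Finset.mem_insert, Finset.mem_image,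
    Set.Finite.mem_toFinset, SetLike.mem_coe] at hv
  have hlast : v (Fin.last m) ≠ 0 := hv W (Or.inl rfl)
  let c : Fin m → K := fun i => -(v (Fin.last m))⁻¹ * v i.castSucc
  have hφv : φ v = ∑ i, C (v i) * X i := by
    rw [Fintype.linearCombination_apply]
    exact Finset.sum_congr rfl fun i _ => smul_eq_C_mul _ _
  have hlin : C (v (Fin.last m)) * linForm c = φ v := by
    rw [hφv]
    simp only [linForm, c, Fin.sum_univ_castSucc, mul_sub, Finset.mul_sum, ← mul_assoc, ← C_mul]
    simp [hlast, add_comm]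
  refine ⟨c, fun p hp => ?_⟩
  by_contra hpJ
  have hzero : φ v ∈ ⋃ P ∈ associatedPrimes A (A ⧸ J), (P : Set A) := by
    rw [biUnion_associatedPrimes_eq_zero_divisors]
    refine ⟨Ideal.Quotient.mk J p, fun h => hpJ (Ideal.Quotient.eq_zero_iff_mem.1 h), ?_⟩
    have hm : φ v * p ∈ J := by
      rw [← hlin, mul_assoc]
      exact J.mul_mem_left _ hp
    exact Ideal.Quotient.eq_zero_iff_mem.2 hm
  obtain ⟨P, hP, hmem⟩ := Set.mem_iUnion₂.1 hzero
  exact hv (V P) (Or.inr ⟨P, hP, rfl⟩) hmem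

end NonZeroDivisor

section MonomialIdeal

variable {K : Type} [Field K] {n : ℕ}

variable (K) in
/-- The ideal generated by the monomials with exponent in a given set. -/
noncomputable def monomialIdeal (U : Set (Fin n → ℕ)) : Ideal (MvPolynomial (Fin n) K) :=
  Ideal.span ((fun a => monomial a 1) '' {a : Fin n →₀ ℕ | (a : Fin n → ℕ) ∈ U})

variable {U : Set (Fin n → ℕ)}

theorem mem_monomialIdeal (hU : IsUpperSet U) {p : MvPolynomial (Fin n) K} :
    p ∈ monomialIdeal K U ↔ ∀ a ∈ p.support, (a : Fin n → ℕ) ∈ U := by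
  rw [monomialIdeal, mem_ideal_span_monomial_image]
  exact ⟨fun h a ha => let ⟨b, hb, hba⟩ := h a ha; hU hba hb, fun h a ha => ⟨a, h a ha, le_rfl⟩⟩

theorem monomial_mem_monomialIdeal (hU : IsUpperSet U) {a : Fin n →₀ ℕ} :
    monomial a (1 : K) ∈ monomialIdeal K U ↔ (a : Fin n → ℕ) ∈ U := by
  classical
  rw [mem_monomialIdeal hU, support_monomial, if_neg one_ne_zero]
  simp

theorem homogeneousComponent_mem_monomialIdeal (hU : IsUpperSet U)
    {p : MvPolynomial (Fin n) K} (hp : p ∈ monomialIdeal K U) (e : ℕ) :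
    homogeneousComponent e p ∈ monomialIdeal K U := by
  classical
  rw [mem_monomialIdeal hU] at hp ⊢
  intro a ha
  rw [support_homogeneousComponent] at ha
  exact hp a (Finset.mem_filter.1 ha).1

theorem isLeading_monomialIdeal (hU : IsUpperSet U) {x : Fin n → ℕ} :
    IsLeading (monomialIdeal K U) x ↔ x ∈ U := by
  classical
  constructor
  · rintro ⟨p, hp, -, hx, -⟩
    exact (mem_monomialIdeal hU).1 hp _ (mem_support_iff.2 hx)
  · intro hx
    refine ⟨monomial (expFinsupp x) 1, (monomial_mem_monomialIdeal hU).2 hx,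
      monomial_mem_homogeneousSubmodule rfl, ?_, fun y hy => ?_⟩
    · simp
    · rw [coeff_monomial, if_neg]
      rintro h
      rw [Finsupp.equivFunOnFinite.symm.injective h] at hy
      exact lt_irrefl _ hy

theorem stdExponents_monomialIdeal (hU : IsUpperSet U) {d : ℕ} {x : Fin n → ℕ} :
    x ∈ stdExponents (monomialIdeal K U) d ↔ ∑ i, x i = d ∧ x ∉ U := by
  rw [mem_stdExponents, isLeading_monomialIdeal hU]

theorem isUpperSet_preimage_castSucc (hU : IsUpperSet U) :
    IsUpperSet {y : Fin (n + 1) → ℕ | y ∘ Fin.castSucc ∈ U} :=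
  fun _ _ hxy hx => hU (fun i => hxy i.castSucc) hx

theorem map_rename_monomialIdeal (hU : IsUpperSet U) :
    (monomialIdeal K U).map
        (rename Fin.castSucc : MvPolynomial (Fin n) K →ₐ[K] MvPolynomial (Fin (n + 1)) K) =
      monomialIdeal K {y : Fin (n + 1) → ℕ | y ∘ Fin.castSucc ∈ U} := by
  apply le_antisymm
  · rw [monomialIdeal, Ideal.map_span, Ideal.span_le]
    rintro _ ⟨_, ⟨a, ha, rfl⟩, rfl⟩
    rw [SetLike.mem_coe]
    dsimp only
    rw [rename_monomial,
      monomial_mem_monomialIdeal (isUpperSet_preimage_castSucc hU)]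
    have : (Finsupp.mapDomain Fin.castSucc a : Fin (n + 1) → ℕ) ∘ Fin.castSucc = a := by
      funext i
      exact Finsupp.mapDomain_apply (Fin.castSucc_injective n) a i
    rwa [Set.mem_ofPred_eq, this]
  · rw [monomialIdeal, Ideal.span_le]
    rintro _ ⟨y, hy, rfl⟩
    have hmem : monomial (expFinsupp ((y : Fin (n + 1) → ℕ) ∘ Fin.castSucc)) (1 : K) ∈
        monomialIdeal K U := (monomial_mem_monomialIdeal hU).2 hy
    have hy' : y = Finsupp.mapDomain Fin.castSucc
        (expFinsupp ((y : Fin (n + 1) → ℕ) ∘ Fin.castSucc)) +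
          Finsupp.single (Fin.last n) (y (Fin.last n)) := by
      ext i
      induction i using Fin.lastCases with
      | last =>
        rw [Finsupp.add_apply, Finsupp.mapDomain_of_notMem_range _ _ (by simp)]
        simp
      | cast i =>
        rw [Finsupp.add_apply, Finsupp.mapDomain_apply (Fin.castSucc_injective n)]
        simp
    have := Ideal.mul_mem_right (monomial (Finsupp.single (Fin.last n) (y (Fin.last n))) 1) _
      (Ideal.mem_map_of_mem (rename Fin.castSucc :
        MvPolynomial (Fin n) K →ₐ[K] MvPolynomial (Fin (n + 1)) K) hmem)
    rw [rename_monomial, monomial_mul, one_mul, ← hy'] at this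
    exact this

theorem linForm_zero_mul_mem (hU : IsUpperSet U) {p : MvPolynomial (Fin (n + 1)) K}
    (hp : linForm 0 * p ∈ monomialIdeal K {y : Fin (n + 1) → ℕ | y ∘ Fin.castSucc ∈ U}) :
    p ∈ monomialIdeal K {y : Fin (n + 1) → ℕ | y ∘ Fin.castSucc ∈ U} := by
  have hlin : (linForm 0 : MvPolynomial (Fin (n + 1)) K) = X (Fin.last n) := by simp [linForm]
  rw [hlin, mem_monomialIdeal (isUpperSet_preimage_castSucc hU)] at hp
  rw [mem_monomialIdeal (isUpperSet_preimage_castSucc hU)]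
  intro a ha
  have := hp (Finsupp.single (Fin.last n) 1 + a)
    (by rwa [mem_support_iff, coeff_X_mul, ← mem_support_iff])
  have hcomp : (Finsupp.single (Fin.last n) 1 + a : Fin (n + 1) →₀ ℕ) ∘ Fin.castSucc =
      (a : Fin (n + 1) → ℕ) ∘ Fin.castSucc := by
    funext i
    simp
  rwa [Set.mem_ofPred_eq, hcomp] at this

theorem map_substLast_map_rename (c : Fin n → K) (L : Ideal (MvPolynomial (Fin n) K)) :
    (L.map (rename Fin.castSucc :
      MvPolynomial (Fin n) K →ₐ[K] MvPolynomial (Fin (n + 1)) K)).map (substLast c) = L := by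
  rw [Ideal.map_mapₐ]
  have : (substLast c).comp (rename Fin.castSucc) = AlgHom.id K _ := by
    ext i
    simp
  rw [this]
  exact Ideal.map_id L

theorem hilb_map_rename_monomialIdeal_zero (hU : IsUpperSet U) :
    hilb K ((monomialIdeal K U).map
        (rename Fin.castSucc : MvPolynomial (Fin n) K →ₐ[K] MvPolynomial (Fin (n + 1)) K)) 0 =
      hilb K (monomialIdeal K U) 0 := by
  conv_rhs => rw [← map_substLast_map_rename 0 (monomialIdeal K U)]
  rw [map_rename_monomialIdeal hU]
  exact (hilb_map_substLast_zero 0 fun p hp e =>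
    homogeneousComponent_mem_monomialIdeal (isUpperSet_preimage_castSucc hU) hp e).symm

theorem hilb_map_rename_monomialIdeal_succ (hU : IsUpperSet U) (d : ℕ) :
    hilb K ((monomialIdeal K U).map
        (rename Fin.castSucc : MvPolynomial (Fin n) K →ₐ[K] MvPolynomial (Fin (n + 1)) K)) (d + 1) =
      hilb K (monomialIdeal K U) (d + 1) + hilb K ((monomialIdeal K U).map
        (rename Fin.castSucc : MvPolynomial (Fin n) K →ₐ[K] MvPolynomial (Fin (n + 1)) K)) d := by
  have h := hilb_map_substLast_succ 0 (fun p hp e =>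
    homogeneousComponent_mem_monomialIdeal (K := K) (isUpperSet_preimage_castSucc hU) hp e)
    (fun p hp => linForm_zero_mul_mem hU hp) d
  rw [← map_rename_monomialIdeal hU, map_substLast_map_rename] at h
  exact h.symm

end MonomialIdeal

section LexIdeal

variable {K : Type} [Field K] {n : ℕ}

/-- The exponents left after removing, in each degree, as many lexicographically smallest exponents
as there are standard exponents of `J`. -/
def lexExponents (J : Ideal (MvPolynomial (Fin n) K)) : Set (Fin n → ℕ) :=
  {m | (stdExponents J (∑ i, m i)).card ≤ lexRank m}

theorem isUpperSet_lexExponents (J : Ideal (MvPolynomial (Fin n) K)) :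
    IsUpperSet (lexExponents J) := by
  classical
  intro x y hxy hx
  by_contra hy
  set B : Finset (Fin n → ℕ) := (Finset.range (∑ i, y i + 1)).biUnion (stdExponents J) with hB
  have hmem : ∀ z, z ∈ B ↔ ∑ i, z i ≤ ∑ i, y i ∧ ¬ IsLeading J z := by
    intro z
    simp [hB, mem_stdExponents]
  have hcard : ∀ e ≤ ∑ i, y i, B.filter (fun z => ∑ i, z i = e) = stdExponents J e := by
    intro e he
    ext z
    rw [Finset.mem_filter, hmem, mem_stdExponents]
    constructor
    · rintro ⟨⟨-, h⟩, h'⟩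
      exact ⟨h', h⟩
    · rintro ⟨h, h'⟩
      exact ⟨⟨h.trans_le he, h'⟩, h⟩
  have hlower : IsLowerSet (B : Set (Fin n → ℕ)) := by
    intro u v hvu hu
    rw [Finset.mem_coe, hmem] at hu ⊢
    exact ⟨(Finset.sum_le_sum fun i _ => hvu i).trans hu.1, isLowerSet_not_isLeading J hvu hu.2⟩
  have hxy' : ∑ i, x i ≤ ∑ i, y i := Finset.sum_le_sum fun i _ => hxy i
  have hyB : lexRank y < (B.filter fun z => ∑ i, z i = ∑ i, y i).card := by
    rw [hcard _ le_rfl]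
    exact not_le.1 hy
  have h : lexRank x < (B.filter fun z => ∑ i, z i = ∑ i, x i).card :=
    isLowerSet_lexRank_lt n B hlower hxy hyB
  rw [hcard _ hxy'] at h
  exact h.not_ge hx

theorem hilb_monomialIdeal_lexExponents {F : Type} [Field F]
    (J : Ideal (MvPolynomial (Fin n) F)) (d : ℕ) :
    hilb K (monomialIdeal K (lexExponents J)) d = hilb F J d := by
  classical
  rw [hilb_eq_card, hilb_eq_card,
    ← card_filter_lexRank_lt (k := (stdExponents J d).card) (n := n) (d := d)
      (Finset.card_le_card (Finset.filter_subset _ _))]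
  congr 1
  ext x
  rw [stdExponents_monomialIdeal (isUpperSet_lexExponents J), Finset.mem_filter,
    Finset.mem_piAntidiag]
  constructor
  · rintro ⟨rfl, h⟩
    exact ⟨by simp, not_le.1 h⟩
  · rintro ⟨⟨rfl, -⟩, h⟩
    exact ⟨rfl, not_le.2 h⟩

theorem isLexsegment_monomialIdeal_lexExponents {F : Type} [Field F]
    (J : Ideal (MvPolynomial (Fin (n + 1)) F)) :
    IsLexsegment (monomialIdeal K (lexExponents J)) := by
  have hU := isUpperSet_lexExponents J
  refine ⟨fun p hp a ha => ?_, fun a b hab ha hlt => ?_⟩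
  · exact (monomial_mem_monomialIdeal hU).2 ((mem_monomialIdeal hU).1 hp a ha)
  · rw [monomial_mem_monomialIdeal hU] at ha ⊢
    rw [lexExponents, Set.mem_ofPred_eq] at ha ⊢
    rw [← hab]
    exact ha.trans (lexRank_lt_lexRank hab hlt).le

end LexIdeal

/-- Let `R = K[x_0,…,x_n] ⊆ S = K[x_0,…,x_{n+1}]` and let `I ⊆ S` be a
homogeneous ideal which is saturated, i.e. for every `f ∈ S`, if `x_i · f ∈ I` for all
`i` then `f ∈ I`.  Writing `h_{S/I}(d) = dim_K (S/I)_d` (with `h_{S/I}(-1) = 0`), there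
is a lexsegment ideal `L ⊆ R` with `dim_K (R/L)_d = h_{S/I}(d) - h_{S/I}(d-1)` for all
`d ≥ 0` and `dim_K (S/(L·S))_d = h_{S/I}(d)` for all `d ≥ 0`. -/
theorem statement0 (K : Type) [Field K] (n : ℕ)
    (I : Ideal (MvPolynomial (Fin (n+2)) K))
    (hI : ∀ p ∈ I, ∀ e : ℕ, homogeneousComponent e p ∈ I)
    (hsat : ∀ p : MvPolynomial (Fin (n+2)) K, (∀ i : Fin (n+2), X i * p ∈ I) → p ∈ I) :
    ∃ L : Ideal (MvPolynomial (Fin (n+1)) K),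
      (∀ p ∈ L, ∀ e : ℕ, homogeneousComponent e p ∈ L) ∧
      IsLexsegment L ∧
      hilb K L 0 = hilb K I 0 ∧
      (∀ d : ℕ, (hilb K L (d+1) : ℤ) = (hilb K I (d+1) : ℤ) - (hilb K I d : ℤ)) ∧
      (∀ d : ℕ, hilb K (Ideal.map
          (rename (Fin.castSucc : Fin (n+1) → Fin (n+2)) :
            MvPolynomial (Fin (n+1)) K →ₐ[K] MvPolynomial (Fin (n+2)) K) L) d =
        hilb K I d) := by
  have hJ : ∀ p ∈ extendIdeal (AlgebraicClosure K) I, ∀ e,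
      homogeneousComponent e p ∈ extendIdeal (AlgebraicClosure K) I :=
    fun p hp e => homogeneousComponent_mem_extendIdeal hI hp e
  have : Infinite (AlgebraicClosure K) := inferInstance
  obtain ⟨c, hc⟩ := exists_linForm_mul_mem (J := extendIdeal (AlgebraicClosure K) I)
    fun p hp => mem_extendIdeal_of_forall_X_mul_mem hsat hp
  set J := (extendIdeal (AlgebraicClosure K) I).map (substLast c)
  have hU := isUpperSet_lexExponents J
  have hzero : hilb K (monomialIdeal K (lexExponents J)) 0 = hilb K I 0 := by
    rw [hilb_monomialIdeal_lexExponents, hilb_map_substLast_zero c hJ, hilb_extendIdeal]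
  have hsucc : ∀ d, hilb K (monomialIdeal K (lexExponents J)) (d + 1) + hilb K I d =
      hilb K I (d + 1) := by
    intro d
    rw [hilb_monomialIdeal_lexExponents, ← hilb_extendIdeal (F := AlgebraicClosure K) I,
      hilb_map_substLast_succ c hJ hc, hilb_extendIdeal]
  refine ⟨monomialIdeal K (lexExponents J),
    fun p hp e => homogeneousComponent_mem_monomialIdeal hU hp e,
    isLexsegment_monomialIdeal_lexExponents J, hzero, fun d => ?_, fun d => ?_⟩
  · rw [← hsucc d]
    push_cast
    ring
  · induction d with
    | zero => rw [hilb_map_rename_monomialIdeal_zero hU, hzero]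
    | succ d ih => rw [hilb_map_rename_monomialIdeal_succ hU, ih, hsucc]
end

section
/- Let D ∈ ℕ. Assume G(d) = F(d) for all d ≥ D; g(d) ≤ G(d) − G(d−1) ≤ f(d) for all d > D; G(d−1) − G(d−2) ≥ m(d, G(d) − G(d−1)) for all d ≥ D+2; and m(D+1, G(D+1) − G(D)) ≤ g(D). Then the map h ↦ (Δh(0), Δh(1), …, Δh(D)) is a bijection from L(G,F,g,f) onto K(D, G(D), g(D)). -/
/-- `Mset G F g f d` is the set of tuples `(ℓ_0, …, ℓ_d) ∈ ℤ^{d+1}` such that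
`G i ≤ ℓ_0 + ⋯ + ℓ_i ≤ F i` and `g i ≤ ℓ_i ≤ f i` for all `0 ≤ i ≤ d`. -/
def Mset (G F g f : ℕ → ℤ) (d : ℕ) : Set (Fin (d+1) → ℤ) :=
  {ℓ | ∀ i : Fin (d+1), (G i ≤ ∑ k ∈ Finset.Iic i, ℓ k ∧ ∑ k ∈ Finset.Iic i, ℓ k ≤ F i) ∧
    (g i ≤ ℓ i ∧ ℓ i ≤ f i)}

/-- `Msum G F g f d c` is `M(d, c)`, the tuples in `M(d)` with total sum `c`. -/
def Msum (G F g f : ℕ → ℤ) (d : ℕ) (c : ℤ) : Set (Fin (d+1) → ℤ) :=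
  {ℓ ∈ Mset G F g f d | ∑ k, ℓ k = c}
/-- `Kset G F g f m d c k` is `K(d, c, k)`: tuples `ℓ ∈ M(d,c)` with
`ℓ_{i-1} ≥ m(i, ℓ_i)` for all `1 ≤ i ≤ d` and `ℓ_d ≥ k`. -/
def Kset (G F g f : ℕ → ℤ) (m : ℕ → ℤ → ℤ) (d : ℕ) (c k : ℤ) : Set (Fin (d+1) → ℤ) :=
  {ℓ ∈ Msum G F g f d c |
    (∀ i : Fin d, m ((i : ℕ) + 1) (ℓ i.succ) ≤ ℓ i.castSucc) ∧ k ≤ ℓ (Fin.last d)}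
/-- `Δ h d = h d - h (d-1)`, with the convention `h (-1) = 0`. -/
def Δ (h : ℕ → ℤ) : ℕ → ℤ
  | 0 => h 0
  | d+1 => h (d+1) - h d
/-- `Lset G F g f m` is the family of numeric functions `h` with
`G d ≤ h d ≤ F d`, `g d ≤ Δh d ≤ f d` for all `d ≥ 0`, and
`Δh (d-1) ≥ m(d, Δh d)` for all `d ≥ 1`. -/
def Lset (G F g f : ℕ → ℤ) (m : ℕ → ℤ → ℤ) : Set (ℕ → ℤ) :=
  {h | (∀ d : ℕ, (G d ≤ h d ∧ h d ≤ F d) ∧ (g d ≤ Δ h d ∧ Δ h d ≤ f d)) ∧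
    ∀ d : ℕ, m (d+1) (Δ h (d+1)) ≤ Δ h d}

theorem sum_range_succ_Δ (h : ℕ → ℤ) (n : ℕ) : ∑ k ∈ Finset.range (n + 1), Δ h k = h n := by
  induction n with
  | zero => simp [Δ]
  | succ n ih => rw [Finset.sum_range_succ, ih, Δ]; ring

theorem sum_Iic_fin_val {n : ℕ} (a : ℕ → ℤ) (i : Fin n) :
    ∑ k ∈ Finset.Iic i, a k = ∑ k ∈ Finset.range ((i : ℕ) + 1), a k := by
  rw [Nat.range_succ_eq_Iic, ← Fin.map_valEmbedding_Iic, Finset.sum_map]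
  rfl

/-- The function whose differences up to `D` are `a 0, …, a D` and which agrees with `G` beyond
`D`. -/
def extendSum (G a : ℕ → ℤ) (D n : ℕ) : ℤ :=
  if n ≤ D then ∑ k ∈ Finset.range (n + 1), a k else G n

theorem extendSum_of_le {G a : ℕ → ℤ} {D n : ℕ} (hn : n ≤ D) :
    extendSum G a D n = ∑ k ∈ Finset.range (n + 1), a k :=
  if_pos hn

theorem extendSum_of_ge {G a : ℕ → ℤ} {D n : ℕ} (ha : ∑ k ∈ Finset.range (D + 1), a k = G D)
    (hn : D ≤ n) : extendSum G a D n = G n := by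
  rcases hn.eq_or_lt with rfl | hn
  · rw [extendSum_of_le le_rfl, ha]
  · exact if_neg hn.not_ge

theorem Δ_extendSum_of_le {G a : ℕ → ℤ} {D n : ℕ} (hn : n ≤ D) :
    Δ (extendSum G a D) n = a n := by
  cases n with
  | zero => simp [Δ, extendSum]
  | succ n =>
    rw [Δ, extendSum_of_le hn, extendSum_of_le (by omega), Finset.sum_range_succ]
    ring

theorem Δ_extendSum_of_ge {G a : ℕ → ℤ} {D n : ℕ} (ha : ∑ k ∈ Finset.range (D + 1), a k = G D)
    (hn : D ≤ n) : Δ (extendSum G a D) (n + 1) = G (n + 1) - G n := by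
  rw [Δ, extendSum_of_ge ha (by omega), extendSum_of_ge ha hn]

/-- Membership in `Kset` for the restriction of a function on `ℕ`, in terms of natural indices. -/
theorem restrict_mem_Kset_iff {G F g f : ℕ → ℤ} {m : ℕ → ℤ → ℤ} {D : ℕ} {c k : ℤ} {a : ℕ → ℤ} :
    (fun i : Fin (D + 1) => a i) ∈ Kset G F g f m D c k ↔
      (∀ n ≤ D, (G n ≤ ∑ k ∈ Finset.range (n + 1), a k ∧
        ∑ k ∈ Finset.range (n + 1), a k ≤ F n) ∧ (g n ≤ a n ∧ a n ≤ f n)) ∧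
      ∑ k ∈ Finset.range (D + 1), a k = c ∧
      (∀ n < D, m (n + 1) (a (n + 1)) ≤ a n) ∧ k ≤ a D := by
  simp only [Kset, Msum, Mset, Set.mem_ofPred_eq, sum_Iic_fin_val,
    Fin.sum_univ_eq_sum_range (fun n => a n), Fin.forall_iff, Fin.val_succ, Fin.val_castSucc,
    Fin.val_last, Nat.lt_succ_iff, and_assoc]

/-- if `G d = F d` for all `d ≥ D`; `g d ≤ G d - G (d-1) ≤ f d` for all
`d > D`; `G (d-1) - G (d-2) ≥ m(d, G d - G (d-1))` for all `d ≥ D+2`; and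
`m(D+1, G (D+1) - G D) ≤ g D`, then `h ↦ (Δh 0, …, Δh D)` is a bijection from
`L(G,F,g,f)` onto `K(D, G D, g D)`. -/
theorem statement12 (G F g f : ℕ → ℤ) (m : ℕ → ℤ → ℤ) (D : ℕ)
    (hGF : ∀ d : ℕ, D ≤ d → G d = F d)
    (hgf : ∀ d : ℕ, D < d → g d ≤ G d - G (d - 1) ∧ G d - G (d - 1) ≤ f d)
    (hmG : ∀ d : ℕ, D + 2 ≤ d → m d (G d - G (d - 1)) ≤ G (d - 1) - G (d - 2))
    (hmg : m (D + 1) (G (D + 1) - G D) ≤ g D) :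
    Set.BijOn (fun h (i : Fin (D+1)) => Δ h i) (Lset G F g f m)
      (Kset G F g f m D (G D) (g D)) := by
  refine ⟨fun h ⟨hb, hm⟩ => ?_, fun h ⟨hb, _⟩ h' ⟨hb', _⟩ heq => ?_, fun ℓ hℓ => ?_⟩
  · refine restrict_mem_Kset_iff.2 ⟨fun n _ => ?_, ?_, fun n _ => hm n, (hb D).2.1⟩
    · rw [sum_range_succ_Δ]
      exact hb n
    · rw [sum_range_succ_Δ]
      have := hGF D le_rfl
      have := (hb D).1
      omega
  · funext n
    rcases le_total n D with hn | hn
    · rw [← sum_range_succ_Δ h, ← sum_range_succ_Δ h']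
      refine Finset.sum_congr rfl fun k hk => ?_
      exact congrFun heq ⟨k, by rw [Finset.mem_range] at hk; omega⟩
    · have := hGF n hn
      have := (hb n).1
      have := (hb' n).1
      omega
  · obtain ⟨a, rfl⟩ : ∃ a : ℕ → ℤ, (fun i : Fin (D + 1) => a i) = ℓ :=
      ⟨fun n => if hn : n < D + 1 then ℓ ⟨n, hn⟩ else 0, funext fun i => dif_pos i.isLt⟩
    obtain ⟨hb, hsum, hm, hlast⟩ := restrict_mem_Kset_iff.1 hℓ
    refine ⟨extendSum G a D, ⟨fun n => ?_, fun n => ?_⟩, ?_⟩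
    · rcases le_or_gt n D with hn | hn
      · rw [extendSum_of_le hn, Δ_extendSum_of_le hn]
        exact hb n hn
      · obtain ⟨n, rfl⟩ := Nat.exists_eq_succ_of_ne_zero (by omega : n ≠ 0)
        rw [extendSum_of_ge hsum hn.le, Δ_extendSum_of_ge hsum (by omega)]
        exact ⟨⟨le_rfl, (hGF _ hn.le).le⟩, hgf _ hn⟩
    · rcases lt_trichotomy n D with hn | rfl | hn
      · rw [Δ_extendSum_of_le hn, Δ_extendSum_of_le hn.le]
        exact hm n hn
      · rw [Δ_extendSum_of_ge hsum le_rfl, Δ_extendSum_of_le le_rfl]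
        exact hmg.trans hlast
      · obtain ⟨n, rfl⟩ := Nat.exists_eq_succ_of_ne_zero (by omega : n ≠ 0)
        rw [Δ_extendSum_of_ge hsum hn.le, Δ_extendSum_of_ge hsum (by omega)]
        exact hmG (n + 2) (by omega)
    · funext i
      exact Δ_extendSum_of_le (by omega)
end

section
/- Let d ≥ 1 and c, k ∈ ℤ with K(d,c,k) nonempty, and let ArgmaxK(d,c,k) := {ℓ ∈ K(d,c,k) : σ(ℓ) ≥ σ(ℓ') for all ℓ' ∈ K(d,c,k)}. Then ArgmaxK(d,c,k) equals the union, over those j ∈ ℤ with max(g(d),k) ≤ j ≤ f(d), K(d−1, c−j, m(d,j)) nonempty, and sup{σ(ℓ') : ℓ' ∈ K(d−1, c−j, m(d,j))} + V(d,j) = sup{σ(ℓ) : ℓ ∈ K(d,c,k)}, of the sets { (ℓ'_0,…,ℓ'_{d−1}, j) : ℓ' ∈ ArgmaxK(d−1, c−j, m(d,j)) }. -/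
/-- `σ(ℓ) = Σ_{i=0}^{d} V(i, ℓ_i)`. -/
def sigmaV (V : ℕ → ℤ → ℤ) {d : ℕ} (ℓ : Fin (d+1) → ℤ) : ℤ := ∑ i : Fin (d+1), V i (ℓ i)

/-- The supremum of `σ` over a set of tuples, computed in `WithBot ℤ`
(so the supremum of the empty set is `⊥`). -/
noncomputable def supSigma (V : ℕ → ℤ → ℤ) {d : ℕ} (S : Set (Fin (d+1) → ℤ)) : WithBot ℤ :=
  sSup ((fun ℓ => ((sigmaV V ℓ : ℤ) : WithBot ℤ)) '' S)

theorem supSigma_eq_of_forall_le (V : ℕ → ℤ → ℤ) {d : ℕ} {S : Set (Fin (d+1) → ℤ)}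
    {ℓ : Fin (d+1) → ℤ} (hℓ : ℓ ∈ S) (hmax : ∀ ℓ' ∈ S, sigmaV V ℓ' ≤ sigmaV V ℓ) :
    supSigma V S = ((sigmaV V ℓ : ℤ) : WithBot ℤ) := by
  refine IsGreatest.csSup_eq ⟨Set.mem_image_of_mem _ hℓ, ?_⟩
  rintro _ ⟨ℓ', hℓ', rfl⟩
  exact WithBot.coe_le_coe.2 (hmax ℓ' hℓ')

theorem sigmaV_le_supSigma (V : ℕ → ℤ → ℤ) {d : ℕ} {S : Set (Fin (d+1) → ℤ)} (hS : S.Finite)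
    {ℓ : Fin (d+1) → ℤ} (hℓ : ℓ ∈ S) : ((sigmaV V ℓ : ℤ) : WithBot ℤ) ≤ supSigma V S :=
  le_csSup (hS.image _).bddAbove (Set.mem_image_of_mem _ hℓ)

theorem Kset_finite (G F g f : ℕ → ℤ) (m : ℕ → ℤ → ℤ) (d : ℕ) (c k : ℤ) :
    (Kset G F g f m d c k).Finite :=
  (Set.finite_Icc (fun i : Fin (d+1) => g i) (fun i => f i)).subset
    fun _ h => ⟨fun i => (h.1.1 i).2.1, fun i => (h.1.1 i).2.2⟩

theorem sigmaV_snoc (V : ℕ → ℤ → ℤ) {d : ℕ} (ℓ : Fin (d+1) → ℤ) (j : ℤ) :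
    sigmaV V (Fin.snoc ℓ j : Fin (d+2) → ℤ) = sigmaV V ℓ + V (d+1) j := by
  simp [sigmaV, Fin.sum_univ_castSucc (n := d + 1)]

theorem sum_Iic_castSucc_snoc {n : ℕ} (ℓ : Fin n → ℤ) (j : ℤ) (i : Fin n) :
    ∑ k ∈ Finset.Iic i.castSucc, (Fin.snoc ℓ j : Fin (n+1) → ℤ) k = ∑ k ∈ Finset.Iic i, ℓ k := by
  rw [← Fin.map_castSuccEmb_Iic, Finset.sum_map]
  simp

theorem sum_Iic_last {n : ℕ} (ℓ : Fin (n+1) → ℤ) :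
    ∑ k ∈ Finset.Iic (Fin.last n), ℓ k = ∑ k, ℓ k := by
  congr 1
  ext i
  simp [Fin.le_last]

/-- Appending `j` to a tuple `ℓ` gives an element of `K(d+1, c, k)` exactly when
`ℓ ∈ K(d, c - j, m(d+1, j))` and the bounds at the last index hold. -/
theorem snoc_mem_Kset_iff (G F g f : ℕ → ℤ) (m : ℕ → ℤ → ℤ) (d : ℕ) (c k j : ℤ)
    (ℓ : Fin (d+1) → ℤ) :
    (Fin.snoc ℓ j : Fin (d+2) → ℤ) ∈ Kset G F g f m (d+1) c k ↔
      ℓ ∈ Kset G F g f m d (c - j) (m (d+1) j) ∧ (G (d+1) ≤ c ∧ c ≤ F (d+1)) ∧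
        (g (d+1) ≤ j ∧ j ≤ f (d+1)) ∧ k ≤ j := by
  have hsum : ∑ i, (Fin.snoc ℓ j : Fin (d+2) → ℤ) i = ∑ i, ℓ i + j := by
    simp [Fin.sum_univ_castSucc (n := d + 1)]
  simp only [Kset, Msum, Mset, Set.mem_ofPred_eq, Fin.forall_fin_succ' (n := d + 1),
    sum_Iic_castSucc_snoc, sum_Iic_last, hsum, Fin.snoc_castSucc, Fin.snoc_last,
    Fin.val_castSucc, Fin.val_last, Fin.forall_fin_succ' (n := d) (P := fun i : Fin (d+1) =>
      m (i + 1) ((Fin.snoc ℓ j : Fin (d+2) → ℤ) i.succ) ≤ ℓ i), Fin.succ_castSucc, Fin.succ_last]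
  rw [eq_sub_iff_add_eq]
  constructor
  · rintro ⟨⟨⟨hM, hc, hj⟩, rfl⟩, ⟨hm, hm'⟩, hk⟩
    exact ⟨⟨⟨hM, rfl⟩, hm, hm'⟩, hc, hj, hk⟩
  · rintro ⟨⟨⟨hM, rfl⟩, hm, hm'⟩, hc, hj, hk⟩
    exact ⟨⟨⟨hM, hc, hj⟩, rfl⟩, ⟨hm, hm'⟩, hk⟩

/-- for `d ≥ 1` and `c, k ∈ ℤ` with `K(d,c,k)` nonempty, the set of
maximizers of `σ` on `K(d,c,k)` is the union, over those `j` with `max (g d) k ≤ j ≤ f d`,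
`K(d-1, c-j, m(d,j))` nonempty, and `sup σ (K(d-1,c-j,m(d,j))) + V(d,j) = sup σ (K(d,c,k))`,
of the sets obtained by appending `j` to the maximizers of `σ` on `K(d-1, c-j, m(d,j))`. -/
theorem statement14 (G F g f : ℕ → ℤ) (m : ℕ → ℤ → ℤ) (V : ℕ → ℤ → ℤ) (d : ℕ) (c k : ℤ)
    (hne : (Kset G F g f m (d+1) c k).Nonempty) :
    {ℓ ∈ Kset G F g f m (d+1) c k |
        ∀ ℓ' ∈ Kset G F g f m (d+1) c k, sigmaV V ℓ' ≤ sigmaV V ℓ} =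
      ⋃ j ∈ {j : ℤ | max (g (d+1)) k ≤ j ∧ j ≤ f (d+1) ∧
          (Kset G F g f m d (c - j) (m (d+1) j)).Nonempty ∧
          supSigma V (Kset G F g f m d (c - j) (m (d+1) j)) + ((V (d+1) j : ℤ) : WithBot ℤ) =
            supSigma V (Kset G F g f m (d+1) c k)},
        (fun ℓ' : Fin (d+1) → ℤ => Fin.snoc ℓ' j) ''
          {ℓ' ∈ Kset G F g f m d (c - j) (m (d+1) j) |
            ∀ ℓ'' ∈ Kset G F g f m d (c - j) (m (d+1) j), sigmaV V ℓ'' ≤ sigmaV V ℓ'} := by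
  obtain ⟨ℓ₀, hℓ₀⟩ := hne
  rw [← Fin.snoc_init_self ℓ₀, snoc_mem_Kset_iff] at hℓ₀
  have hc := hℓ₀.2.1
  ext ℓ
  simp only [Set.mem_iUnion, Set.mem_image, Set.mem_ofPred_eq, exists_prop, max_le_iff]
  constructor
  · rintro ⟨hℓ, hmax⟩
    have hsup := supSigma_eq_of_forall_le V hℓ hmax
    obtain ⟨ℓ', j, rfl⟩ : ∃ (ℓ' : Fin (d+1) → ℤ) (j : ℤ), ℓ = Fin.snoc ℓ' j :=
      ⟨_, _, (Fin.snoc_init_self ℓ).symm⟩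
    obtain ⟨hℓ', -, hj, hk⟩ := (snoc_mem_Kset_iff ..).1 hℓ
    have hmax' : ∀ ℓ'' ∈ Kset G F g f m d (c - j) (m (d+1) j),
        sigmaV V ℓ'' ≤ sigmaV V ℓ' := by
      intro ℓ'' hℓ''
      have h := hmax _ ((snoc_mem_Kset_iff ..).2 ⟨hℓ'', hc, hj, hk⟩)
      rwa [sigmaV_snoc, sigmaV_snoc, add_le_add_iff_right] at h
    refine ⟨j, ⟨⟨hj.1, hk⟩, hj.2, ⟨ℓ', hℓ'⟩, ?_⟩, ℓ', ⟨hℓ', hmax'⟩, rfl⟩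
    rw [hsup, supSigma_eq_of_forall_le V hℓ' hmax', sigmaV_snoc, WithBot.coe_add]
  · rintro ⟨j, ⟨⟨hg, hk⟩, hf, -, hsup⟩, ℓ', ⟨hℓ', hmax'⟩, rfl⟩
    refine ⟨(snoc_mem_Kset_iff ..).2 ⟨hℓ', hc, ⟨hg, hf⟩, hk⟩, fun ℓ'' hℓ'' => ?_⟩
    have h := sigmaV_le_supSigma V (Kset_finite G F g f m (d+1) c k) hℓ''
    rwa [← hsup, supSigma_eq_of_forall_le V hℓ' hmax', ← WithBot.coe_add, ← sigmaV_snoc,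
      WithBot.coe_le_coe] at h
end
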